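/- arXiv:2603.27730 — 10 statements merged into one kernel-verified Lean document; each statement's English description precedes it below -/
import Mathlib

section
/- Let R be a commutative ring that is elementarily equivalent to ℤ in the first-order language of rings, and let d be a positive integer. Then the quotient ring R ⧸ (dR), i.e. R modulo the ideal generated by (d : R), is isomorphic as a ring to ℤ/dℤ (Mathlib: ZMod d). -/
open FirstOrder Language

noncomputable instance : FirstOrder.Ring.CompatibleRing ℤ :=
  FirstOrder.Ring.compatibleRingOfRing ℤ

/-- The sentence saying that `d` divides `n`. -/
noncomputable def FirstOrder.Ring.natDvdSentence (d n : ℕ) : Language.ring.Sentence :=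
  BoundedFormula.ex (n := 0) <| Term.bdEqual
    (FirstOrder.Ring.termOfFreeCommRing (n : FreeCommRing (Empty ⊕ Fin 1)))
    (FirstOrder.Ring.termOfFreeCommRing
      ((d : FreeCommRing (Empty ⊕ Fin 1)) * FreeCommRing.of (Sum.inr 0)))

theorem FirstOrder.Ring.realize_natDvdSentence (R : Type*) [CommRing R]
    [FirstOrder.Ring.CompatibleRing R] (d n : ℕ) :
    R ⊨ FirstOrder.Ring.natDvdSentence d n ↔ (d : R) ∣ (n : R) := by
  simp [Sentence.Realize, Formula.Realize, natDvdSentence, dvd_def, Fin.snoc]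

/-- The sentence saying that every element is congruent modulo `d` to one of `0, …, d - 1`. -/
noncomputable def FirstOrder.Ring.natResidueSentence (d : ℕ) : Language.ring.Sentence :=
  BoundedFormula.all (n := 0) <| BoundedFormula.ex <| BoundedFormula.iSup fun r : Fin d =>
    Term.bdEqual
      (FirstOrder.Ring.termOfFreeCommRing
        (FreeCommRing.of (Sum.inr 0) : FreeCommRing (Empty ⊕ Fin 2)))
      (FirstOrder.Ring.termOfFreeCommRing
        (((r : ℕ) : FreeCommRing (Empty ⊕ Fin 2)) + (d : FreeCommRing (Empty ⊕ Fin 2)) *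
          FreeCommRing.of (Sum.inr 1)))

theorem FirstOrder.Ring.realize_natResidueSentence (R : Type*) [CommRing R]
    [FirstOrder.Ring.CompatibleRing R] (d : ℕ) :
    R ⊨ FirstOrder.Ring.natResidueSentence d ↔
      ∀ x : R, ∃ y : R, ∃ r : Fin d, x = ((r : ℕ) : R) + d * y := by
  simp [Sentence.Realize, Formula.Realize, natResidueSentence, Fin.snoc]

theorem stmt_2 (R : Type*) [CommRing R] [FirstOrder.Ring.CompatibleRing R]
    (h : R ≅[Language.ring] ℤ) (d : ℕ) (hd : 0 < d) :
    Nonempty ((R ⧸ Ideal.span {(d : R)}) ≃+* ZMod d) := by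
  have hdvd (n : ℕ) : (d : R) ∣ (n : R) ↔ d ∣ n := by
    rw [← FirstOrder.Ring.realize_natDvdSentence, h.realize_sentence,
      FirstOrder.Ring.realize_natDvdSentence, Int.natCast_dvd_natCast]
  have hres : ∀ x : R, ∃ y : R, ∃ r : Fin d, x = ((r : ℕ) : R) + d * y := by
    rw [← FirstOrder.Ring.realize_natResidueSentence, h.realize_sentence,
      FirstOrder.Ring.realize_natResidueSentence]
    intro x
    have hd' : (0 : ℤ) < d := by exact_mod_cast hd
    have h0 := Int.emod_nonneg x hd'.ne'
    have h1 := Int.emod_lt_of_pos x hd'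
    refine ⟨x / d, ⟨(x % d).toNat, by omega⟩, ?_⟩
    rw [Int.toNat_of_nonneg h0, Int.emod_add_mul_ediv]
  have : CharP (R ⧸ Ideal.span {(d : R)}) d := ⟨fun n => by
    rw [← hdvd, ← Ideal.mem_span_singleton, ← Ideal.Quotient.eq_zero_iff_mem, map_natCast]⟩
  refine ⟨(RingEquiv.ofBijective (ZMod.castHom dvd_rfl (R ⧸ Ideal.span {(d : R)}))
    ⟨ZMod.castHom_injective _, fun q => ?_⟩).symm⟩
  obtain ⟨x, rfl⟩ := Ideal.Quotient.mk_surjective q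
  obtain ⟨y, r, rfl⟩ := hres x
  refine ⟨(r : ℕ), ?_⟩
  rw [map_natCast, map_add, map_mul, map_natCast, map_natCast,
    CharP.cast_eq_zero (R ⧸ Ideal.span {(d : R)}) d, zero_mul, add_zero]
end

section
/- Let M be a finitely generated abelian group (finitely generated ℤ-module) and let R be a commutative ring that is elementarily equivalent to ℤ in the first-order language of rings. Then the canonical ℤ-linear map M → R ⊗[ℤ] M sending m to 1 ⊗ₜ m is injective. -/
open FirstOrder Language TensorProduct

/-- Divisibility between rational integers is first-order expressible, so it is the same in
elementarily equivalent rings. -/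
theorem intCast_dvd_intCast_iff_of_elementarilyEquivalent {R S : Type*} [CommRing R] [CommRing S]
    [FirstOrder.Ring.CompatibleRing R] [FirstOrder.Ring.CompatibleRing S]
    (h : R ≅[Language.ring] S) (a b : ℤ) : (a : R) ∣ b ↔ (a : S) ∣ b := by
  let t (p : FreeCommRing (Empty ⊕ Fin 1)) := FirstOrder.Ring.termOfFreeCommRing p
  let φ : Language.ring.Sentence :=
    ((t (b : FreeCommRing (Empty ⊕ Fin 1))).bdEqual
      (t ((a : FreeCommRing (Empty ⊕ Fin 1)) * FreeCommRing.of (Sum.inr 0)))).ex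
  have key := h.realize_sentence φ
  simpa [φ, t, Sentence.Realize, Formula.Realize, dvd_def, Fin.snoc] using key

/-- A nonzero element of a finitely generated abelian group has nonzero image in some cyclic
group. -/
theorem exists_addMonoidHom_zmod_apply_ne_zero {M : Type*} [AddCommGroup M] [AddGroup.FG M]
    {m : M} (hm : m ≠ 0) : ∃ (n : ℕ) (f : M →+ ZMod n), f m ≠ 0 := by
  obtain ⟨r, ι, _, p, _, e, ⟨E⟩⟩ := AddCommGroup.equiv_free_prod_directSum_zmod M
  by_contra! H
  refine hm (E.injective ?_)
  rw [map_zero]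
  refine Prod.ext (Finsupp.ext fun i => ?_) (DFinsupp.ext fun i => ?_)
  · exact H 0 ((Finsupp.applyAddHom i).comp ((AddMonoidHom.fst _ _).comp E.toAddMonoidHom))
  · exact H (p i ^ e i)
      ((DFinsupp.evalAddMonoidHom i).comp ((AddMonoidHom.snd _ _).comp E.toAddMonoidHom))

/-- If divisibility of rational integers in `R` implies divisibility in `ℤ`, then tensoring with `R`
detects the elements of a finitely generated abelian group. -/
theorem one_tmul_injective_of_intCast_dvd {R M : Type*} [CommRing R] [AddCommGroup M]
    [Module.Finite ℤ M] (hR : ∀ a b : ℤ, (a : R) ∣ b → a ∣ b) :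
    Function.Injective (TensorProduct.mk ℤ R M 1) := by
  have : AddGroup.FG M := Module.Finite.iff_addGroup_fg.mp ‹_›
  rw [injective_iff_map_eq_zero]
  intro m hm
  by_contra hm0
  obtain ⟨n, f, hf⟩ := exists_addMonoidHom_zmod_apply_ne_zero hm0
  let Q := R ⧸ Ideal.span {((n : ℤ) : R)}
  let c : ZMod n →+ Q := ZMod.lift n ⟨Int.castAddHom Q, by
    have : Ideal.Quotient.mk (Ideal.span {((n : ℤ) : R)}) ((n : ℤ) : R) = 0 :=
      Ideal.Quotient.eq_zero_iff_mem.mpr (Ideal.mem_span_singleton_self _)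
    simpa using this⟩
  let F : R ⊗[ℤ] M →ₗ[ℤ] Q := LinearMap.mul' ℤ Q ∘ₗ TensorProduct.map
    (Ideal.Quotient.mk (Ideal.span {((n : ℤ) : R)})).toAddMonoidHom.toIntLinearMap
    (c.comp f).toIntLinearMap
  have hc : c (f m) = 0 := by
    have h1 : Ideal.Quotient.mk (Ideal.span {((n : ℤ) : R)}) 1 * c (f m) = 0 :=
      (congrArg F hm).trans (map_zero F)
    simpa using h1
  obtain ⟨k, hk⟩ := ZMod.intCast_surjective (f m)
  rw [← hk] at hc hf
  have hQ : Ideal.Quotient.mk (Ideal.span {((n : ℤ) : R)}) (k : R) = 0 := by simpa [c] using hc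
  rw [Ideal.Quotient.eq_zero_iff_mem, Ideal.mem_span_singleton] at hQ
  exact hf ((ZMod.intCast_zmod_eq_zero_iff_dvd k n).mpr (hR _ _ hQ))

theorem stmt_3 (M : Type*) [AddCommGroup M] [Module.Finite ℤ M]
    (R : Type*) [CommRing R] [FirstOrder.Ring.CompatibleRing R]
    (h : R ≅[Language.ring] ℤ) :
    Function.Injective (fun m : M => (1 : R) ⊗ₜ[ℤ] m : M → R ⊗[ℤ] M) :=
  one_tmul_injective_of_intCast_dvd fun a b hab => by
    simpa using (intCast_dvd_intCast_iff_of_elementarilyEquivalent h a b).mp hab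
end

section
/- Let A be an associative unital ring (not necessarily commutative) whose additive group is finitely generated (A is finitely generated as a ℤ-module), and let R be a commutative ring that is elementarily equivalent to ℤ in the first-order language of rings. Then the ring R ⊗[ℤ] A (with the tensor-product ring structure, in which (r ⊗ a)(s ⊗ b) = (rs) ⊗ (ab)) is elementarily equivalent to A in the first-order language of rings. -/
open FirstOrder Language TensorProduct

namespace FirstOrder.Ring

open Language

section RingHom

variable {S T β : Type*} [Ring S] [Ring T] [CompatibleRing S] [CompatibleRing T]

theorem map_realize_term (f : S →+* T) (t : Language.ring.Term β) (v : β → S) :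
    f (t.realize v) = t.realize (f ∘ v) := by
  let F : S →[Language.ring] T :=
    { toFun := f
      map_fun' := fun {n} g x => by cases g <;> simp
      map_rel' := fun {n} r => r.elim }
  exact (HomClass.realize_term F).symm

end RingHom

section Interpretation

variable {A ι κ : Type*} [Ring A] [Fintype ι] [Fintype κ]

/-- The element `∑ i, x i ⊗ a i` of `R ⊗[ℤ] A`. -/
noncomputable def tensorCombination {R : Type*} [CommRing R] (a : ι → A) (x : ι → R) :
    R ⊗[ℤ] A :=
  ∑ i, x i ⊗ₜ[ℤ] a i

section

variable {R S : Type*} [CommRing R] [CommRing S] (a : ι → A)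

theorem tensorCombination_sub (x y : ι → R) :
    tensorCombination a (x - y) = tensorCombination a x - tensorCombination a y := by
  simp [tensorCombination, TensorProduct.sub_tmul]

theorem map_tensorCombination (f : R →+* S) (x : ι → R) :
    Algebra.TensorProduct.map f.toIntAlgHom (AlgHom.id ℤ A) (tensorCombination a x) =
      tensorCombination a (f ∘ x) := by
  simp [tensorCombination]

variable {a}

theorem tensorCombination_surjective (ha : Submodule.span ℤ (Set.range a) = ⊤) :
    Function.Surjective (tensorCombination (R := R) a) := by
  intro z
  induction z with
  | zero => exact ⟨0, by simp [tensorCombination]⟩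
  | add z w hz hw =>
    obtain ⟨x, rfl⟩ := hz
    obtain ⟨y, rfl⟩ := hw
    exact ⟨x + y, by simp [tensorCombination, TensorProduct.add_tmul, Finset.sum_add_distrib]⟩
  | tmul r b =>
    obtain ⟨c, rfl⟩ := (Submodule.mem_span_range_iff_exists_fun ℤ).1
      (show b ∈ Submodule.span ℤ (Set.range a) from ha ▸ Submodule.mem_top)
    refine ⟨fun i => c i • r, ?_⟩
    simp only [tensorCombination, TensorProduct.tmul_sum, TensorProduct.smul_tmul]

theorem tensorCombination_eq_zero_iff (ha : Submodule.span ℤ (Set.range a) = ⊤)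
    {g : κ → ι → ℤ}
    (hg : Submodule.span ℤ (Set.range g) = LinearMap.ker (Fintype.linearCombination ℤ a))
    (x : ι → R) :
    tensorCombination a x = 0 ↔ ∃ c : κ → R, ∀ i, x i = ∑ j, c j * (g j i : R) := by
  constructor
  · intro h
    have h' : ∑ i, a i ⊗ₜ[ℤ] x i = 0 := by
      simpa [tensorCombination] using congrArg (TensorProduct.comm ℤ R A) h
    obtain ⟨n, b, y, hx, hb⟩ := TensorProduct.vanishesTrivially_of_sum_tmul_eq_zero ℤ ha h'
    have hmem (k) : ∃ d : κ → ℤ, ∑ j, d j • g j = fun i => b i k := by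
      rw [← Submodule.mem_span_range_iff_exists_fun, hg, LinearMap.mem_ker,
        Fintype.linearCombination_apply]
      exact hb k
    choose d hd using hmem
    refine ⟨fun j => ∑ k, d k j • y k, fun i => ?_⟩
    rw [hx]
    have hd' (k) : b i k = ∑ j, d k j * g j i := by
      simpa using (congrFun (hd k) i).symm
    simp only [hd', Finset.sum_mul, zsmul_eq_mul, Int.cast_sum, Int.cast_mul]
    rw [Finset.sum_comm]
    exact Finset.sum_congr rfl fun _ _ => Finset.sum_congr rfl fun _ _ => by ring
  · rintro ⟨c, hc⟩
    have hrel (j) : ∑ i, g j i • a i = 0 := by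
      have : g j ∈ LinearMap.ker (Fintype.linearCombination ℤ a) :=
        hg ▸ Submodule.subset_span ⟨j, rfl⟩
      simpa [Fintype.linearCombination_apply] using this
    have hx : x = fun i => ∑ j, g j i • c j := by
      ext i
      simp [hc, mul_comm]
    simp only [tensorCombination, hx, TensorProduct.sum_tmul, TensorProduct.smul_tmul]
    rw [Finset.sum_comm]
    simp only [← TensorProduct.tmul_sum, hrel, TensorProduct.tmul_zero, Finset.sum_const_zero]

end

variable {a : ι → A} {β : Type*}

/-- Coordinates, polynomial in the coordinates of the variables, of the value of a term. -/
noncomputable def termCoordinates (ha : Submodule.span ℤ (Set.range a) = ⊤)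
    (t : Language.ring.Term β) : ι → FreeCommRing (β × ι) :=
  letI := compatibleRingOfRing (FreeCommRing (β × ι) ⊗[ℤ] A)
  Function.surjInv (tensorCombination_surjective ha)
    (t.realize fun b => tensorCombination a fun i => FreeCommRing.of (b, i))

/-- The formula expressing, in coordinates with respect to `a`, that two terms are equal. -/
noncomputable def equalFormula (ha : Submodule.span ℤ (Set.range a) = ⊤) (g : κ → ι → ℤ)
    (t₁ t₂ : Language.ring.Term β) : Language.ring.Formula (β × ι) :=
  Formula.iExs κ <| Formula.iInf fun i =>
    (termOfFreeCommRing (FreeCommRing.map Sum.inl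
        (termCoordinates ha t₁ i - termCoordinates ha t₂ i))).equal
      (termOfFreeCommRing (∑ j, FreeCommRing.of (Sum.inr j) * (g j i : FreeCommRing _)))

/-- The translation of a formula about `R ⊗[ℤ] A` into a formula about `R`, uniform in `R`. -/
noncomputable def tensorFormula (ha : Submodule.span ℤ (Set.range a) = ⊤) (g : κ → ι → ℤ) :
    {n : ℕ} → Language.ring.BoundedFormula β n → Language.ring.Formula ((β ⊕ Fin n) × ι)
  | _, .falsum => ⊥
  | _, .equal t₁ t₂ => equalFormula ha g t₁ t₂
  | _, .rel r _ => r.elim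
  | _, .imp φ ψ => (tensorFormula ha g φ).imp (tensorFormula ha g ψ)
  | _, .all φ => Formula.iAlls ι <| (tensorFormula ha g φ).relabel fun p =>
      Sum.elim (fun b => Sum.inl (Sum.inl b, p.2))
        (Fin.lastCases (Sum.inr p.2) fun k => Sum.inl (Sum.inr k, p.2)) p.1

variable {R : Type*} [CommRing R] [CompatibleRing (R ⊗[ℤ] A)]

theorem realize_term_tensorCombination (ha : Submodule.span ℤ (Set.range a) = ⊤)
    (t : Language.ring.Term β) (x : β × ι → R) :
    t.realize (fun b => tensorCombination a fun i => x (b, i)) =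
      tensorCombination a (FreeCommRing.lift x ∘ termCoordinates ha t) := by
  let _ := compatibleRingOfRing (FreeCommRing (β × ι) ⊗[ℤ] A)
  rw [← map_tensorCombination, termCoordinates,
    Function.surjInv_eq (tensorCombination_surjective ha)]
  refine Eq.trans ?_ (map_realize_term (Algebra.TensorProduct.map
    (FreeCommRing.lift x).toIntAlgHom (AlgHom.id ℤ A)).toRingHom t _).symm
  congr 1
  ext b
  refine Eq.trans ?_ (map_tensorCombination a (FreeCommRing.lift x) _).symm
  congr 1
  ext i
  simp

variable [CompatibleRing R]

theorem realize_equalFormula (ha : Submodule.span ℤ (Set.range a) = ⊤) {g : κ → ι → ℤ}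
    (hg : Submodule.span ℤ (Set.range g) = LinearMap.ker (Fintype.linearCombination ℤ a))
    (t₁ t₂ : Language.ring.Term β) (x : β × ι → R) :
    (equalFormula ha g t₁ t₂).Realize x ↔
      t₁.realize (fun b => tensorCombination a fun i => x (b, i)) =
        t₂.realize (fun b => tensorCombination a fun i => x (b, i)) := by
  rw [realize_term_tensorCombination ha, realize_term_tensorCombination ha, ← sub_eq_zero,
    ← tensorCombination_sub, tensorCombination_eq_zero_iff ha hg]
  have hlift (c : κ → R) (p : FreeCommRing (β × ι)) :
      FreeCommRing.lift (Sum.elim x c) (FreeCommRing.map Sum.inl p) = FreeCommRing.lift x p := by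
    have : (FreeCommRing.lift (Sum.elim x c)).comp (FreeCommRing.map Sum.inl) =
        FreeCommRing.lift x := FreeCommRing.hom_ext fun b => by simp
    exact DFunLike.congr_fun this p
  simp only [equalFormula, Formula.realize_iExs, Formula.realize_iInf, Formula.realize_equal,
    realize_termOfFreeCommRing, hlift]
  simp

theorem realize_tensorFormula (ha : Submodule.span ℤ (Set.range a) = ⊤) {g : κ → ι → ℤ}
    (hg : Submodule.span ℤ (Set.range g) = LinearMap.ker (Fintype.linearCombination ℤ a))
    {n : ℕ} (φ : Language.ring.BoundedFormula β n) (x : (β ⊕ Fin n) × ι → R) :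
    (tensorFormula ha g φ).Realize x ↔
      φ.Realize (fun b => tensorCombination a fun i => x (Sum.inl b, i))
        (fun k => tensorCombination a fun i => x (Sum.inr k, i)) := by
  induction φ with
  | falsum => rfl
  | equal t₁ t₂ =>
    rw [tensorFormula, realize_equalFormula ha hg, BoundedFormula.Realize]
    have : (fun b => tensorCombination a fun i => x (b, i)) =
        Sum.elim (fun b => tensorCombination a fun i => x (Sum.inl b, i))
          (fun k => tensorCombination a fun i => x (Sum.inr k, i)) := by
      ext (b | k) <;> rfl
    rw [this]
  | rel r _ => exact r.elim
  | imp φ ψ ihφ ihψ =>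
    rw [tensorFormula, Formula.realize_imp, ihφ, ihψ, BoundedFormula.realize_imp]
  | all φ ih =>
    rw [tensorFormula, Formula.realize_iAlls, BoundedFormula.realize_all,
      (tensorCombination_surjective ha).forall]
    refine forall_congr' fun y => ?_
    rw [Formula.realize_relabel, ih]
    refine iff_of_eq (congrArg _ ?_)
    ext k
    cases k using Fin.lastCases <;> simp

/-- The translation of a sentence about `R ⊗[ℤ] A` into a sentence about `R`. -/
noncomputable def tensorSentence (ha : Submodule.span ℤ (Set.range a) = ⊤) (g : κ → ι → ℤ)
    (φ : Language.ring.Sentence) : Language.ring.Sentence :=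
  (tensorFormula ha g φ).relabel fun p => p.1.elim id Fin.elim0

theorem realize_tensorSentence (ha : Submodule.span ℤ (Set.range a) = ⊤) {g : κ → ι → ℤ}
    (hg : Submodule.span ℤ (Set.range g) = LinearMap.ker (Fintype.linearCombination ℤ a))
    (φ : Language.ring.Sentence) :
    R ⊨ tensorSentence ha g φ ↔ (R ⊗[ℤ] A) ⊨ φ := by
  rw [Sentence.Realize, tensorSentence, Formula.realize_relabel, realize_tensorFormula ha hg,
    Sentence.Realize, Formula.Realize]
  exact iff_of_eq (congrArg₂ _ (Subsingleton.elim _ _) (Subsingleton.elim _ _))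

theorem tensorProduct_elementarilyEquivalent [Module.Finite ℤ A] {S : Type*} [CommRing S]
    [CompatibleRing S] [CompatibleRing (S ⊗[ℤ] A)] (h : R ≅[Language.ring] S) :
    (R ⊗[ℤ] A) ≅[Language.ring] (S ⊗[ℤ] A) := by
  obtain ⟨n, a, ha⟩ := Module.Finite.exists_fin (R := ℤ) (M := A)
  obtain ⟨m, g, hg⟩ := Submodule.fg_iff_exists_fin_generating_family.1
    (IsNoetherian.noetherian (LinearMap.ker (Fintype.linearCombination ℤ a)))
  rw [elementarilyEquivalent_iff] at h ⊢
  intro φ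
  rw [← realize_tensorSentence ha hg, ← realize_tensorSentence ha hg, h]

end Interpretation

end FirstOrder.Ring

theorem stmt_5 (A : Type*) [Ring A] [Module.Finite ℤ A]
    (R : Type*) [CommRing R] [FirstOrder.Ring.CompatibleRing R]
    (hR : R ≅[Language.ring] ℤ)
    [FirstOrder.Ring.CompatibleRing A]
    [FirstOrder.Ring.CompatibleRing (R ⊗[ℤ] A)] :
    (R ⊗[ℤ] A) ≅[Language.ring] A := by
  let _ := FirstOrder.Ring.compatibleRingOfRing (ℤ ⊗[ℤ] A)
  refine (FirstOrder.Ring.tensorProduct_elementarilyEquivalent hR).trans ?_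
  exact StrongHomClass.elementarilyEquivalent
    (FirstOrder.Ring.languageEquivEquivRingEquiv.symm
      (Algebra.TensorProduct.lid ℤ A).toRingEquiv)
end

section
/- Let A be an associative unital ring (not necessarily commutative) whose additive group is finitely generated (A is finitely generated as a ℤ-module). Then there exists a sentence φ in the first-order language of rings such that A satisfies φ, and for every associative unital ring B that is finitely generated as a ring (i.e., B equals the subring closure of some finite subset), if B satisfies φ then B is isomorphic to A as a ring. -/
open FirstOrder Language

universe u

section Arithmetic

open scoped Nat

/-- A ring that is finitely generated as an abelian group and has positive characteristic
is finite. -/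
theorem finite_of_natCast_eq_zero {O : Type*} [CommRing O] [Module.Finite ℤ O] {m : ℕ}
    (hm : m ≠ 0) (h : (m : O) = 0) : Finite O := by
  refine Module.finite_of_fg_torsion O fun {x} => ⟨⟨(m : ℤ), ?_⟩, ?_⟩
  · exact mem_nonZeroDivisors_of_ne_zero (by exact_mod_cast hm)
  · show (m : ℤ) • x = 0
    simp [zsmul_eq_mul, h]

theorem charZero_of_infinite {O : Type*} [CommRing O] [Module.Finite ℤ O] [Infinite O] :
    CharZero O := by
  refine charZero_of_inj_zero fun m hm => ?_
  by_contra h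
  exact not_finite_iff_infinite.mpr ‹_› (finite_of_natCast_eq_zero h hm)

theorem eq_one_of_isUnit_natCast {O : Type*} [CommRing O] [IsDomain O] [CharZero O]
    [Module.Finite ℤ O] {m : ℕ} (h : IsUnit (m : O)) : m = 1 := by
  have h1 := h.map (Algebra.norm ℤ)
  have h2 : ((m : ℕ) : O) = algebraMap ℤ O m := by simp
  rw [h2, Algebra.norm_algebraMap, isUnit_pow_iff Module.finrank_pos.ne', Int.isUnit_iff] at h1
  omega

theorem exists_nat_dvd {O : Type*} [CommRing O] [IsDomain O] [Module.Finite ℤ O] [CharZero O]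
    {z : O} (hz : z ≠ 0) : ∃ m : ℕ, m ≠ 0 ∧ z ∣ (m : O) := by
  obtain ⟨r, hr, hd⟩ := (Algebra.IsIntegral.isIntegral (R := ℤ) z).isAlgebraic.exists_nonzero_dvd
    (mem_nonZeroDivisors_of_ne_zero hz)
  refine ⟨r.natAbs, by simpa using hr, ?_⟩
  rw [eq_intCast] at hd
  rcases Int.natAbs_eq r with h | h
  · rw [h] at hd; simpa using hd
  · rw [h] at hd; simpa using hd

theorem exists_nat_forall_dvd {O : Type*} [CommRing O] [IsDomain O] [Module.Finite ℤ O]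
    [CharZero O] {X : Set O} (hX : X.Finite) :
    ∃ g : ℕ, g ≠ 0 ∧ ∀ z ∈ X, z ≠ 0 → z ∣ (g : O) := by
  induction X, hX using Set.Finite.induction_on with
  | empty => exact ⟨1, one_ne_zero, by simp⟩
  | @insert a s _ _ ih =>
    obtain ⟨g, hg, h⟩ := ih
    by_cases ha : a = 0
    · refine ⟨g, hg, ?_⟩
      rintro z (rfl | hz) hz0
      exacts [absurd ha hz0, h z hz hz0]
    · obtain ⟨m, hm, hd⟩ := exists_nat_dvd ha
      refine ⟨m * g, mul_ne_zero hm hg, ?_⟩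
      rintro z (rfl | hz) hz0 <;> push_cast
      exacts [hd.mul_right _, (h z hz hz0).mul_left _]

/-- In an order of rank at most `D`, only finitely many elements `x` have all their shifts
`x + 1, …, x + D` dividing a fixed nonzero element. -/
theorem finite_setOf_shift_dvd {O : Type*} [CommRing O] [IsDomain O] [Module.Finite ℤ O]
    [CharZero O] {D : ℕ} (hD : Module.finrank ℤ O ≤ D) {f : O} (hf : f ≠ 0) :
    {x : O | ∀ i : Fin D, x + ((i : ℕ) + 1) ∣ f}.Finite := by
  classical
  have : Module.Free ℤ O := inferInstance
  have hNf : Algebra.norm ℤ f ≠ 0 := Algebra.norm_ne_zero_iff.mpr hf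
  have hdiv : {c : Fin D → ℤ | ∀ i, c i ∣ Algebra.norm ℤ f}.Finite := by
    have := Set.Finite.pi' (ι := Fin D) (t := fun _ => {c : ℤ | c ∣ Algebra.norm ℤ f})
      (fun _ => by
        refine (Set.finite_Icc (-|Algebra.norm ℤ f|) |Algebra.norm ℤ f|).subset fun c hc => ?_
        exact abs_le.mp (Int.le_of_dvd (abs_pos.mpr hNf) ((abs_dvd_abs _ _).mpr hc)))
    exact this
  refine (hdiv.biUnion
    (t := fun c => {x : O | ∀ i : Fin D, Algebra.norm ℤ (x + ((i : ℕ) + 1)) = c i}) ?_).subset ?_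
  · intro c _
    rcases Set.eq_empty_or_nonempty {x : O | ∀ i : Fin D, Algebra.norm ℤ (x + ((i : ℕ) + 1)) = c i}
      with h | ⟨x₀, hx₀⟩
    · rw [h]; exact Set.finite_empty
    set p := (Algebra.lmul ℤ O x₀).charpoly with hp
    refine (Polynomial.finite_setOfPred_isRoot
      (p := p.map (algebraMap ℤ O)) ?_).subset fun x hx => ?_
    · exact ((LinearMap.charpoly_monic _).map _).ne_zero
    have key : (Algebra.lmul ℤ O x).charpoly = p := by
      refine Polynomial.eq_of_degree_le_of_eval_finset_eq
        (Finset.univ.image fun i : Fin D => (-((i : ℕ) + 1) : ℤ)) ?_ ?_ ?_ ?_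
      · rw [Finset.card_image_of_injective _ (by intro i j h; ext; simp at h; omega)]
        rw [Polynomial.degree_eq_natDegree (LinearMap.charpoly_monic _).ne_zero,
          LinearMap.charpoly_natDegree]
        simpa using hD
      · rw [hp, Polynomial.degree_eq_natDegree (LinearMap.charpoly_monic _).ne_zero,
          Polynomial.degree_eq_natDegree (LinearMap.charpoly_monic _).ne_zero,
          LinearMap.charpoly_natDegree, LinearMap.charpoly_natDegree]
      · rw [(LinearMap.charpoly_monic _).leadingCoeff, (LinearMap.charpoly_monic _).leadingCoeff]
      · have aux : ∀ (y : O) (i : ℕ), (Algebra.lmul ℤ O y).charpoly.eval (-((i : ℕ) + 1) : ℤ) =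
            (-1) ^ Module.finrank ℤ O * Algebra.norm ℤ (y + ((i : ℕ) + 1)) := by
          intro y i
          rw [LinearMap.eval_charpoly, Algebra.norm_apply, ← LinearMap.det_smul]
          congr 1
          ext z
          simp
          ring
        simp only [Finset.mem_image, Finset.mem_univ, true_and]
        rintro _ ⟨i, rfl⟩
        rw [hp, aux, aux, hx i, hx₀ i]
    have hch := LinearMap.aeval_self_charpoly (Algebra.lmul ℤ O x)
    rw [key] at hch
    have h2 : Polynomial.aeval x p = 0 := by
      have h3 := congrArg (fun e : Module.End ℤ O => e 1) hch
      have h4 : Polynomial.aeval (Algebra.lmul ℤ O x) p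
          = Algebra.lmul ℤ O (Polynomial.aeval x p) :=
        Polynomial.aeval_algHom_apply (Algebra.lmul ℤ O) x p
      simp only [h4] at h3
      simpa using h3
    exact (Polynomial.eval_map_algebraMap p x).trans h2
  · intro x hx
    simp only [Set.mem_iUnion]
    exact ⟨fun i : Fin D => Algebra.norm ℤ (x + ((i : ℕ) + 1)),
      fun i => map_dvd (Algebra.norm ℤ) (hx i), fun i => rfl⟩

/-- A first-order condition on an element `n` of a commutative ring. In rings with finite residue
fields it forces `n` to be a natural number; in orders of rank at most `D` every natural number
satisfies it. The first alternative serves finite rings. In the second, `{x | u ∣ x * w}` is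
required to be a maximal ideal, and the elements `x` with `x + 1, …, x + D` dividing `f` and
`1 + (x + 1) * g` not coprime to `h` are required to form a set that injects into the residue
field, contains `0`, and is closed under successor except at `n`. -/
def NatCode (D : ℕ) {O : Type*} [CommRing O] (n : O) : Prop :=
  (∃ k : Fin D, n = ((k : ℕ) : O)) ∨
  ∃ u w f g h : O,
    let M : O → Prop := fun x => ∃ y, x * w = u * y
    let S : O → Prop := fun x => (∀ i : Fin D, ∃ y, (x + ((i : ℕ) + 1)) * y = f) ∧
      ¬ ∃ a b, a * (1 + (x + 1) * g) + b * h = 1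
    ¬ M 1 ∧ (∀ x, M x ∨ ∃ y, M (x * y - 1)) ∧ S 0 ∧
    (∀ x, S x → (x = n ∨ S (x + 1)) ∧ x + 1 ≠ 0) ∧
    ∀ x y, S x → S y → M (x - y) → x = y

theorem NatCode.exists_eq_natCast {O : Type*} [CommRing O]
    (hO : ∀ I : Ideal O, I.IsMaximal → Finite (O ⧸ I)) {D : ℕ} {n : O} (h : NatCode D n) :
    ∃ k : ℕ, n = k := by
  rcases h with ⟨k, hk⟩ | ⟨u, w, f, g, h, h1, h2, h3, h4, h5⟩
  · exact ⟨k, hk⟩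
  set S : O → Prop := fun x => (∀ i : Fin D, ∃ y, (x + ((i : ℕ) + 1)) * y = f) ∧
      ¬ ∃ a b, a * (1 + (x + 1) * g) + b * h = 1
  let I : Ideal O :=
    { carrier := {x | ∃ y, x * w = u * y}
      add_mem' := by
        rintro a b ⟨y, hy⟩ ⟨z, hz⟩
        exact ⟨y + z, by rw [add_mul, hy, hz, mul_add]⟩
      zero_mem' := ⟨0, by simp⟩
      smul_mem' := by
        rintro c x ⟨y, hy⟩
        exact ⟨c * y, by rw [smul_eq_mul, mul_assoc, hy]; ring⟩ }
  have hI : I.IsMaximal := by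
    refine Ideal.isMaximal_iff.mpr ⟨h1, fun J x hIJ hxI hxJ => ?_⟩
    rcases h2 x with hx | ⟨y, hy⟩
    · exact absurd hx hxI
    · have : x * y - (x * y - 1) ∈ J := J.sub_mem (J.mul_mem_right _ hxJ) (hIJ hy)
      simpa using this
  have := hO I hI
  by_contra hn
  push Not at hn
  have hS : ∀ k : ℕ, S k := by
    intro k
    induction k with
    | zero => rw [Nat.cast_zero]; exact h3
    | succ k ih =>
      rcases (h4 k ih).1 with h | h
      · exact absurd h.symm (hn k)
      · simpa using h
  obtain ⟨i, j, hij, he⟩ := Finite.exists_ne_map_eq_of_infinite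
    (fun k : ℕ => Ideal.Quotient.mk I (k : O))
  wlog hlt : i < j generalizing i j
  · exact this j i hij.symm he.symm (by omega)
  have hji : (j : O) = i := h5 _ _ (hS j) (hS i) (Ideal.Quotient.eq.mp he.symm)
  obtain ⟨d, rfl⟩ := Nat.exists_eq_add_of_lt hlt
  refine (h4 d (hS d)).2 ?_
  push_cast at hji
  linear_combination hji

theorem natCode_natCast_of_finite {O : Type*} [CommRing O] [Finite O] {D : ℕ}
    (hD : Nat.card O ≤ D) (n : ℕ) : NatCode D (n : O) := by
  have hpos : 0 < Nat.card O := Nat.card_pos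
  refine Or.inl ⟨⟨n % Nat.card O, (Nat.mod_lt _ hpos).trans_le hD⟩, ?_⟩
  have h0 : ((Nat.card O : ℕ) : O) = 0 := by
    have := card_nsmul_eq_zero' (G := O) (x := 1)
    simpa using this
  conv_lhs => rw [← Nat.mod_add_div n (Nat.card O)]
  push_cast
  rw [h0]; simp

theorem natCode_natCast_of_charZero {O : Type*} [CommRing O] [IsDomain O] [CharZero O]
    [Module.Finite ℤ O] {D : ℕ} (hD : Module.finrank ℤ O ≤ D) (n : ℕ) :
    NatCode D (n : O) := by
  have hNoeth : IsNoetherianRing O := isNoetherian_of_tower ℤ inferInstance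
  have hf : (((n + D)! : ℕ) : O) ≠ 0 := by exact_mod_cast Nat.factorial_ne_zero _
  have hX := finite_setOf_shift_dvd hD hf
  set X := {x : O | ∀ i : Fin D, x + ((i : ℕ) + 1) ∣ (((n + D)! : ℕ) : O)}
  obtain ⟨g, hg0, hg⟩ := exists_nat_forall_dvd (hX.image2 (· - ·) hX)
  obtain ⟨p, hpn, hp⟩ := Nat.exists_infinite_primes (n + 1)
  have hpO : Ideal.span {(p : O)} ≠ ⊤ := by
    rw [Ne, Ideal.span_singleton_eq_top]
    exact fun h => hp.one_lt.ne' (eq_one_of_isUnit_natCast h)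
  have : Nontrivial (O ⧸ Ideal.span {(p : O)}) := Ideal.Quotient.nontrivial_iff.mpr hpO
  obtain ⟨I, hI⟩ := associatedPrimes.nonempty O (O ⧸ Ideal.span {(p : O)})
  obtain ⟨hIp, w', hw⟩ := isAssociatedPrime_iff.mp hI
  obtain ⟨w, rfl⟩ := Ideal.Quotient.mk_surjective w'
  have hmem : ∀ x, x ∈ I ↔ ∃ y, x * w = p * y := by
    intro x
    rw [hw, Submodule.mem_colon_singleton, Submodule.mem_bot, ← Ideal.Quotient.mk_eq_mk,
      ← Submodule.Quotient.mk_smul, Ideal.Quotient.mk_eq_mk, Ideal.Quotient.eq_zero_iff_mem,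
      Ideal.mem_span_singleton]
    rfl
  have hpI : (p : O) ∈ I := (hmem _).mpr ⟨w, rfl⟩
  have : Finite (O ⧸ I) := finite_of_natCast_eq_zero hp.ne_zero (by
    rw [← map_natCast (Ideal.Quotient.mk I)]
    exact Ideal.Quotient.eq_zero_iff_mem.mpr hpI)
  have hmax : I.IsMaximal := Ideal.Quotient.maximal_of_isField I (Finite.isField_of_domain _)
  set h : O := ∏ j ∈ Finset.range (n + 1), (1 + ((j : O) + 1) * g)
  have hS : ∀ x : O, ((∀ i : Fin D, ∃ y, (x + ((i : ℕ) + 1)) * y = (((n + D)! : ℕ) : O)) ∧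
      ¬ ∃ a b, a * (1 + (x + 1) * g) + b * h = 1) ↔ ∃ j ≤ n, x = (j : ℕ) := by
    intro x
    constructor
    · rintro ⟨hx1, hx2⟩
      by_contra! hne
      refine hx2 (IsCoprime.prod_right fun j hj => ?_)
      have hjn : j ≤ n := by simpa [Nat.lt_succ_iff] using hj
      have hxX : x ∈ X := fun i => (hx1 i).imp fun y hy => hy.symm
      have hjX : (j : O) ∈ X := fun i => by
        have : j + (i + 1) ∣ (n + D)! := Nat.dvd_factorial (by omega) (by omega)
        exact_mod_cast Nat.cast_dvd_cast (α := O) this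
      obtain ⟨t, ht⟩ := hg (x - j) ⟨x, hxX, j, hjX, rfl⟩ (sub_ne_zero.mpr (hne j hjn))
      refine ⟨1 + (x + 1) * t * (j + 1), - (x + 1) ^ 2 * t, ?_⟩
      linear_combination (x + 1) * ht
    · rintro ⟨j, hj, rfl⟩
      constructor
      · intro i
        have : j + (i + 1) ∣ (n + D)! := Nat.dvd_factorial (by omega) (by omega)
        obtain ⟨y, hy⟩ := Nat.cast_dvd_cast (α := O) this
        exact ⟨y, by rw [hy]; push_cast; ring⟩
      · intro hc
        have hd : (1 + ((j : O) + 1) * g) ∣ h :=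
          Finset.dvd_prod_of_mem (fun j : ℕ => (1 + ((j : O) + 1) * g)) (by simp; omega)
        have hu : IsUnit (1 + ((j : O) + 1) * g) := IsCoprime.isUnit_of_dvd' hc dvd_rfl hd
        have := eq_one_of_isUnit_natCast (O := O) (m := 1 + (j + 1) * g) (by push_cast; exact hu)
        simp at this
        exact hg0 this
  refine Or.inr ⟨p, w, ((n + D)! : ℕ), g, h, ?_⟩
  simp only [hS, ← hmem]
  refine ⟨fun h1 => hmax.ne_top ((Ideal.eq_top_iff_one I).mpr h1), fun x => ?_,
    ⟨0, by simp⟩, ?_, ?_⟩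
  · by_cases hx : x ∈ I
    · exact Or.inl hx
    · obtain ⟨y, i, hi, hy⟩ := hmax.exists_inv hx
      refine Or.inr ⟨y, ?_⟩
      have : x * y - 1 = -i := by linear_combination hy
      rw [this]
      exact I.neg_mem hi
  · rintro _ ⟨j, hj, rfl⟩
    refine ⟨?_, by exact_mod_cast Nat.succ_ne_zero j⟩
    rcases hj.eq_or_lt with rfl | hlt
    · exact Or.inl rfl
    · exact Or.inr ⟨j + 1, hlt, by push_cast; rfl⟩
  · rintro _ _ ⟨i, hi, rfl⟩ ⟨j, hj, rfl⟩ hij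
    by_contra hne
    have hne' : (i : ℤ) - j ≠ 0 := fun h => hne (by congr 1; omega)
    have hcop : IsCoprime ((i : ℤ) - j) p := by
      rw [Int.isCoprime_iff_gcd_eq_one, Int.gcd_eq_natAbs, Int.natAbs_natCast]
      exact Nat.Coprime.symm ((Nat.coprime_of_lt_prime (by omega) (by omega) hp))
    obtain ⟨a, b, hab⟩ := hcop
    refine hmax.ne_top ((Ideal.eq_top_iff_one I).mpr ?_)
    have : (1 : O) = a * (i - j) + b * p := by exact_mod_cast congrArg (Int.cast (R := O)) hab.symm
    rw [this]
    exact I.add_mem (I.mul_mem_left _ hij) (I.mul_mem_left _ hpI)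

theorem exists_natCode_natCast {Z : Type*} [CommRing Z] [Module.Finite ℤ Z] (Q : Ideal Z)
    [Q.IsPrime] : ∃ D₀, ∀ D ≥ D₀, ∀ n : ℕ, NatCode D (n : Z ⧸ Q) := by
  rcases finite_or_infinite (Z ⧸ Q) with h | h
  · exact ⟨Nat.card (Z ⧸ Q), fun D hD n => natCode_natCast_of_finite hD n⟩
  · have := charZero_of_infinite (O := Z ⧸ Q)
    exact ⟨Module.finrank ℤ (Z ⧸ Q), fun D hD n => natCode_natCast_of_charZero hD n⟩

end Arithmetic

section Filtration

open Subring

variable {R : Type*} [Ring R]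

/-- The span of the first `i` terms of a sequence over the center of the ring. -/
def partialSpan (a : ℕ → R) (i : ℕ) : Submodule (center R) R :=
  Submodule.span (center R) (Set.range fun j : Fin i => a j)

/-- The ideal of the center that multiplies the `i`-th term of a sequence into the span of the
preceding terms. -/
def stepIdeal (a : ℕ → R) (i : ℕ) : Ideal (center R) :=
  (partialSpan a i).comap (LinearMap.toSpanSingleton (center R) R (a i))

theorem mem_stepIdeal {a : ℕ → R} {i : ℕ} {z : center R} :
    z ∈ stepIdeal a i ↔ (z : R) * a i ∈ partialSpan a i := Iff.rfl

theorem mem_partialSpan {a : ℕ → R} {i : ℕ} {x : R} :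
    x ∈ partialSpan a i ↔ ∃ z : Fin i → center R, ∑ j, (z j : R) * a j = x :=
  Submodule.mem_span_range_iff_exists_fun _

theorem partialSpan_succ (a : ℕ → R) (i : ℕ) :
    partialSpan a (i + 1) = partialSpan a i ⊔ Submodule.span (center R) {a i} := by
  rw [partialSpan, partialSpan, ← Submodule.span_union]
  congr 1
  ext x
  simp only [Set.mem_range, Set.mem_union, Set.mem_singleton_iff]
  constructor
  · rintro ⟨j, rfl⟩
    induction j using Fin.lastCases with
    | last => exact Or.inr rfl
    | cast j => exact Or.inl ⟨j, rfl⟩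
  · rintro (⟨j, rfl⟩ | rfl)
    exacts [⟨j.castSucc, rfl⟩, ⟨Fin.last i, rfl⟩]

theorem mem_partialSpan_succ {a : ℕ → R} {i : ℕ} {x : R} :
    x ∈ partialSpan a (i + 1) ↔ ∃ y ∈ partialSpan a i, ∃ z : center R, y + z * a i = x := by
  rw [partialSpan_succ, Submodule.mem_sup]
  simp only [Submodule.mem_span_singleton, exists_exists_eq_and]
  rfl

theorem partialSpan_congr {a b : ℕ → R} {i : ℕ} (h : ∀ j < i, a j = b j) :
    partialSpan a i = partialSpan b i := by
  have : (fun j : Fin i => a j) = fun j : Fin i => b j := funext fun j => h j j.2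
  rw [partialSpan, partialSpan, this]

theorem stepIdeal_congr {a b : ℕ → R} {i : ℕ} (h : ∀ j ≤ i, a j = b j) :
    stepIdeal a i = stepIdeal b i := by
  ext z
  rw [mem_stepIdeal, mem_stepIdeal, h i le_rfl, partialSpan_congr fun j hj => h j hj.le]

/-- A Noetherian module over the center has a filtration with cyclic quotients whose annihilators
are prime. -/
theorem exists_partialSpan_eq_top [IsNoetherianRing (center R)] [IsNoetherian (center R) R] :
    ∃ (l : ℕ) (a : ℕ → R), partialSpan a l = ⊤ ∧ ∀ i < l, (stepIdeal a i).IsPrime := by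
  let P : Set (Submodule (center R) R) :=
    {N | ∃ (l : ℕ) (a : ℕ → R), partialSpan a l = N ∧ ∀ i < l, (stepIdeal a i).IsPrime}
  have hP : P.Nonempty := ⟨_, 0, fun _ => 0, rfl, by simp⟩
  obtain ⟨N, ⟨l, a, rfl, ha⟩, hmax⟩ := set_has_maximal_iff_noetherian.mpr ‹_› P hP
  refine ⟨l, a, ?_, ha⟩
  by_contra hne
  have : Nontrivial (R ⧸ partialSpan a l) := Submodule.Quotient.nontrivial_iff.mpr hne
  obtain ⟨I, hI⟩ := associatedPrimes.nonempty (center R) (R ⧸ partialSpan a l)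
  obtain ⟨hIp, x', hx⟩ := isAssociatedPrime_iff.mp hI
  obtain ⟨x, rfl⟩ := Submodule.Quotient.mk_surjective _ x'
  let a' : ℕ → R := Function.update a l x
  have ha' : ∀ j < l, a' j = a j := fun j hj => Function.update_of_ne hj.ne _ _
  have hl : a' l = x := Function.update_self ..
  have hIs : stepIdeal a' l = I := by
    ext z
    rw [mem_stepIdeal, hl, partialSpan_congr ha', hx, Submodule.mem_colon_singleton,
      Submodule.mem_bot, ← Submodule.Quotient.mk_smul, Submodule.Quotient.mk_eq_zero]
    rfl
  refine hmax (partialSpan a' (l + 1)) ⟨l + 1, a', rfl, fun i hi => ?_⟩ ?_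
  · rcases Nat.lt_succ_iff_lt_or_eq.mp hi with hi | rfl
    · rw [stepIdeal_congr fun j hj => ha' j (hj.trans_lt hi)]
      exact ha i hi
    · rw [hIs]; exact hIp
  · rw [partialSpan_succ, partialSpan_congr ha', hl, left_lt_sup,
      Submodule.span_singleton_le_iff_mem]
    intro hxm
    refine hIp.ne_top ((Ideal.eq_top_iff_one I).mpr ?_)
    rw [← hIs, mem_stepIdeal, hl, partialSpan_congr ha']
    simpa using hxm

end Filtration

section ResidueFields

theorem isJacobsonRing_int : IsJacobsonRing ℤ := by
  refine isJacobsonRing_iff_prime_eq.mpr fun P hP => ?_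
  by_cases h0 : P = ⊥
  · subst h0
    rw [eq_bot_iff]
    intro x hx
    rw [Ideal.mem_jacobson_bot] at hx
    have h1 := Int.isUnit_iff.mp (hx x)
    have h2 := Int.isUnit_iff.mp (hx (-x))
    rw [Ideal.mem_bot]
    by_contra hx0
    have : 0 < x * x := mul_self_pos.mpr hx0
    have h3 : x * x + 1 = 1 ∨ x * x + 1 = -1 := h1
    omega
  · have := hP.isMaximal h0
    exact Ideal.jacobson_eq_self_of_isMaximal

theorem finite_of_isField_of_finiteType_int {K : Type*} [CommRing K] [inst : Algebra ℤ K]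
    [Algebra.FiniteType ℤ K] (hK : IsField K) : Finite K := by
  obtain rfl : inst = Ring.toIntAlgebra K := Subsingleton.elim _ _
  have := isJacobsonRing_int
  have : Module.Finite ℤ K :=
    let _ := hK.toField
    finite_of_finite_type_of_isJacobsonRing ℤ K
  have := hK.isDomain
  have hinj : ¬ Function.Injective (algebraMap ℤ K) := fun h =>
    Int.not_isField (isField_of_isIntegral_of_isField h hK)
  rw [injective_iff_map_eq_zero] at hinj
  push Not at hinj
  obtain ⟨m, hm, hm0⟩ := hinj
  refine finite_of_natCast_eq_zero (m := m.natAbs) (by simpa using hm0) ?_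
  rw [eq_intCast] at hm
  rcases Int.natAbs_eq m with h | h
  · rw [h] at hm; simpa using hm
  · rw [h] at hm; simpa using hm

open Subring in
theorem finite_center_quotient {R : Type*} [Ring R] [Module.Finite (center R) R]
    (hR : ∃ s : Finset R, Subring.closure (s : Set R) = ⊤) (I : Ideal (center R))
    (hI : I.IsMaximal) : Finite (center R ⧸ I) := by
  obtain ⟨s, hs⟩ := hR
  have hfg : (⊤ : Subalgebra ℤ R).FG := by
    refine ⟨s, top_le_iff.mp fun x _ => ?_⟩
    have hx : x ∈ Subring.closure (s : Set R) := hs ▸ Subring.mem_top x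
    exact (Subring.closure_le (t := (Algebra.adjoin ℤ (s : Set R)).toSubring)).mpr
      Algebra.subset_adjoin hx
  obtain ⟨C, hC, hCR⟩ := exists_subalgebra_of_fg ℤ (center R) R hfg Module.Finite.fg_top
  have hNC : IsNoetherianRing C := isNoetherianRing_of_fg hC
  have hft : Algebra.FiniteType ℤ (center R) := by
    refine ⟨Algebra.fg_trans' (C.fg_top.2 hC) (Subalgebra.fg_of_submodule_fg ?_)⟩
    have : Module.Finite C R := ⟨hCR⟩
    exact fg_of_injective (IsScalarTower.toAlgHom C (center R) R).toLinearMap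
      Subtype.val_injective
  have : Algebra.FiniteType ℤ (center R ⧸ I) :=
    hft.of_surjective (Ideal.Quotient.mk I).toIntAlgHom Ideal.Quotient.mk_surjective
  exact finite_of_isField_of_finiteType_int
    ((Ideal.Quotient.maximal_ideal_iff_isField_quotient I).mp hI)

end ResidueFields

section Coding

open Subring

/-- The data of a finite presentation of the additive group of a ring, of its multiplication, of
generators of its center and of a filtration by spans over the center. -/
structure RingCode where
  /-- The number of additive generators. -/
  n : ℕ
  /-- The number of central generators. -/
  m : ℕ
  /-- The length of the filtration. -/
  l : ℕ
  /-- The parameter used to code natural numbers. -/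
  D : ℕ
  /-- The sequence defining the filtration. -/
  b : ℕ → Fin n
  /-- The generators that are central. -/
  c : Fin m → Fin n
  /-- The steps of the filtration of characteristic zero. -/
  T : Set ℕ
  /-- The additive relations. -/
  rels : Finset (Fin n → ℤ)
  /-- The structure constants. -/
  mul : Fin n → Fin n → Fin n → ℤ
  /-- The coordinates of the unit. -/
  one : Fin n → ℤ

/-- The generators `v` and the central generators `w` of a ring satisfy the first-order conditions
described by a code. -/
structure RingCode.Holds (K : RingCode) {R : Type*} [Ring R] (v : Fin K.n → R)
    (w : Fin K.m → center R) : Prop where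
  mem_top : ∀ x : R, x ∈ partialSpan (v ∘ K.b) K.l
  coe_eq : ∀ k, (w k : R) = v (K.c k)
  exists_sub_mem : ∀ (i : Fin K.l) (x : center R), ∃ z : Fin K.m → center R,
    (∀ k, NatCode K.D (Ideal.Quotient.mk (stepIdeal (v ∘ K.b) i) (z k))) ∧
      x - ∑ k, z k * w k ∈ stepIdeal (v ∘ K.b) i
  notMem : ∀ i : Fin K.l, v (K.b i) ∉ partialSpan (v ∘ K.b) i
  natCode_zero : ∀ i : Fin K.l, ↑i ∈ K.T →
    NatCode K.D (Ideal.Quotient.mk (stepIdeal (v ∘ K.b) i) 0)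
  natCode_succ : ∀ i : Fin K.l, ↑i ∈ K.T → ∀ x : center R,
    NatCode K.D (Ideal.Quotient.mk (stepIdeal (v ∘ K.b) i) x) →
      NatCode K.D (Ideal.Quotient.mk (stepIdeal (v ∘ K.b) i) (x + 1)) ∧
        x + 1 ∉ stepIdeal (v ∘ K.b) i
  rel : ∀ r ∈ K.rels, ∑ k, r k • v k = 0
  mul_eq : ∀ j k, v j * v k = ∑ i, K.mul j k i • v i
  one_eq : (1 : R) = ∑ i, K.one i • v i

variable {R : Type*} [Ring R] {K : RingCode} {v : Fin K.n → R} {w : Fin K.m → center R}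

theorem RingCode.Holds.moduleFinite (h : K.Holds v w) : Module.Finite (center R) R :=
  ⟨Submodule.fg_def.mpr ⟨_, Set.finite_range _, Submodule.eq_top_iff'.mpr h.mem_top⟩⟩

theorem exists_sub_natCast_mem
    (hZ : ∀ I : Ideal (center R), I.IsMaximal → Finite (center R ⧸ I))
    {D : ℕ} {I : Ideal (center R)} {x : center R} (h : NatCode D (Ideal.Quotient.mk I x)) :
    ∃ k : ℕ, x - k ∈ I := by
  have hO : ∀ J : Ideal (center R ⧸ I), J.IsMaximal → Finite ((center R ⧸ I) ⧸ J) := by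
    intro J hJ
    have := hZ (J.comap (Ideal.Quotient.mk I))
      (Ideal.comap_isMaximal_of_surjective _ Ideal.Quotient.mk_surjective)
    exact Finite.of_surjective (Ideal.quotientMap J (Ideal.Quotient.mk I) le_rfl)
      (Ideal.quotientMap_surjective Ideal.Quotient.mk_surjective)
  obtain ⟨k, hk⟩ := h.exists_eq_natCast hO
  exact ⟨k, Ideal.Quotient.eq.mp (by rw [hk, map_natCast])⟩

theorem RingCode.Holds.span_eq_top (h : K.Holds v w)
    (hZ : ∀ I : Ideal (center R), I.IsMaximal → Finite (center R ⧸ I)) :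
    Submodule.span ℤ (Set.range v) = ⊤ := by
  set G := Submodule.span ℤ (Set.range v) with hG
  have hv : ∀ k, v k ∈ G := fun k => Submodule.subset_span ⟨k, rfl⟩
  have hmul : ∀ x ∈ G, ∀ y ∈ G, x * y ∈ G := by
    have hle : G * G ≤ G := by
      rw [hG, Submodule.span_mul_span, Submodule.span_le]
      rintro _ ⟨_, ⟨j, rfl⟩, _, ⟨k, rfl⟩, rfl⟩
      show v j * v k ∈ G
      rw [h.mul_eq]
      exact G.sum_mem fun i _ => G.smul_mem _ (hv i)
    exact fun x hx y hy => hle (Submodule.mul_mem_mul hx hy)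
  have key : ∀ i ≤ K.l, ∀ x ∈ partialSpan (v ∘ K.b) i, x ∈ G := by
    intro i
    induction i with
    | zero =>
      intro _ x hx
      obtain ⟨z, rfl⟩ := mem_partialSpan.mp hx
      simp
    | succ i ih =>
      intro hi x hx
      obtain ⟨y, hy, z, rfl⟩ := mem_partialSpan_succ.mp hx
      obtain ⟨t, ht, hz⟩ := h.exists_sub_mem ⟨i, hi⟩ z
      choose q hq using fun k => exists_sub_natCast_mem hZ (ht k)
      have h1 : z - ∑ k, (q k : center R) * w k ∈ stepIdeal (v ∘ K.b) i := by
        have : z - ∑ k, (q k : center R) * w k =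
            (z - ∑ k, t k * w k) + ∑ k, (t k - q k) * w k := by
          simp only [sub_mul, Finset.sum_sub_distrib]; ring
        rw [this]
        exact add_mem hz (sum_mem fun k _ => Ideal.mul_mem_right _ _ (hq k))
      refine add_mem (ih (by omega) y hy) ?_
      have h2 := ih (by omega) _ (mem_stepIdeal.mp h1)
      have h3 : ((∑ k, (q k : center R) * w k : center R) : R) * (v ∘ K.b) i ∈ G := by
        refine hmul _ ?_ _ (hv _)
        rw [AddSubmonoidClass.coe_finsetSum]
        refine sum_mem fun k _ => ?_
        have : (((q k : center R) * w k : center R) : R) = q k • v (K.c k) := by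
          simp [h.coe_eq]
        rw [this]
        exact nsmul_mem (hv _) _
      have := add_mem h2 h3
      rwa [← add_mul, ← Subring.coe_add, sub_add_cancel] at this
  exact Submodule.eq_top_iff'.mpr fun x => key _ le_rfl x (h.mem_top x)

/-- The facts that hold in a ring from which a code is read off. -/
structure RingCode.IsPresentation (K : RingCode) {R : Type*} [Ring R] (v : Fin K.n → R) :
    Prop where
  span_eq_top : Submodule.span ℤ (Set.range v) = ⊤
  mem_span_rels : ∀ r : Fin K.n → ℤ, ∑ k, r k • v k = 0 →
    r ∈ Submodule.span ℤ (K.rels : Set (Fin K.n → ℤ))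
  exists_mul_sub_mem : ∀ i < K.l, ∀ z : center R, z ∉ stepIdeal (v ∘ K.b) i →
    ∃ (y : center R) (k : ℕ), z * y - k ∈ stepIdeal (v ∘ K.b) i ∧ (k = 1 ∨ i ∈ K.T ∧ 0 < k)

theorem RingCode.IsPresentation.exists_ringHom {S : Type*} [Ring S] {v' : Fin K.n → S}
    {w' : Fin K.m → center S} (h : K.Holds v w) (hp : K.IsPresentation v) (h' : K.Holds v' w') :
    ∃ f : R →+* S, ∀ k, f (v k) = v' k := by
  let L := Fintype.linearCombination ℤ v
  let L' := Fintype.linearCombination ℤ v'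
  have hL : Function.Surjective L := by
    rw [← LinearMap.range_eq_top, Fintype.range_linearCombination, hp.span_eq_top]
  have hker : L.ker ≤ L'.ker := by
    intro r hr
    refine Submodule.span_le.mpr (fun r hr => ?_) (hp.mem_span_rels r hr)
    exact h'.rel r hr
  let g : R →ₗ[ℤ] S := (L.ker.liftQ L' hker) ∘ₗ (L.quotKerEquivOfSurjective hL).symm.toLinearMap
  have hg : ∀ r, g (L r) = L' r := by
    intro r
    have : (L.quotKerEquivOfSurjective hL).symm (L r) = L.ker.mkQ r := by
      rw [LinearEquiv.symm_apply_eq]; rfl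
    show L.ker.liftQ L' hker ((L.quotKerEquivOfSurjective hL).symm (L r)) = L' r
    rw [this]
    rfl
  have hgs : ∀ r : Fin K.n → ℤ, g (∑ k, r k • v k) = ∑ k, r k • v' k := hg
  have hgv : ∀ k, g (v k) = v' k := by
    intro k
    simpa [L, L', Fintype.linearCombination_apply_single] using hg (Pi.single k 1)
  refine ⟨⟨⟨⟨g, ?_⟩, ?_⟩, map_zero g, map_add g⟩, hgv⟩
  · rw [h.one_eq, hgs, ← h'.one_eq]
  · intro x y
    obtain ⟨r, rfl⟩ := hL x
    obtain ⟨s, rfl⟩ := hL y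
    show g ((∑ i, r i • v i) * ∑ j, s j • v j) = g (∑ i, r i • v i) * g (∑ j, s j • v j)
    rw [hgs, hgs, Finset.sum_mul_sum, Finset.sum_mul_sum, map_sum]
    refine Finset.sum_congr rfl fun i _ => ?_
    rw [map_sum]
    refine Finset.sum_congr rfl fun j _ => ?_
    rw [smul_mul_smul_comm, smul_mul_smul_comm, map_smul, h.mul_eq, hgs, ← h'.mul_eq]

/-- A finitely generated ring that satisfies the conditions of a code is isomorphic to the ring
from which the code is read off. -/
theorem RingCode.IsPresentation.nonempty_ringEquiv {S : Type*} [Ring S] {v' : Fin K.n → S}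
    {w' : Fin K.m → center S} (h : K.Holds v w) (hp : K.IsPresentation v) (h' : K.Holds v' w')
    (hS : ∃ s : Finset S, Subring.closure (s : Set S) = ⊤) : Nonempty (R ≃+* S) := by
  have := h'.moduleFinite
  have hZ := finite_center_quotient hS
  obtain ⟨f, hf⟩ := hp.exists_ringHom h h'
  have hsurj : Function.Surjective f := by
    have : (⊤ : Submodule ℤ S) ≤ f.toIntAlgHom.toLinearMap.range := by
      rw [← h'.span_eq_top hZ, Submodule.span_le]
      rintro _ ⟨k, rfl⟩
      exact ⟨v k, hf k⟩
    exact fun y => this (Submodule.mem_top (x := y))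
  have hcen : ∀ z : center R, ∃ z' : center S, (z' : S) = f z := by
    intro z
    refine ⟨⟨f z, mem_center_iff.mpr fun y => ?_⟩, rfl⟩
    obtain ⟨x, rfl⟩ := hsurj y
    rw [← map_mul, ← map_mul, mem_center_iff.mp z.2]
  choose F hF using hcen
  have hspan : ∀ i, ∀ x ∈ partialSpan (v ∘ K.b) i, f x ∈ partialSpan (v' ∘ K.b) i := by
    intro i x hx
    obtain ⟨z, rfl⟩ := mem_partialSpan.mp hx
    exact mem_partialSpan.mpr ⟨fun j => F (z j), by simp [hF, hf]⟩
  have hstep : ∀ i, ∀ z ∈ stepIdeal (v ∘ K.b) i, F z ∈ stepIdeal (v' ∘ K.b) i := by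
    intro i z hz
    have := hspan i _ (mem_stepIdeal.mp hz)
    rw [mem_stepIdeal]
    simpa [hF, hf] using this
  have hinj : ∀ i ≤ K.l, ∀ x ∈ partialSpan (v ∘ K.b) i, f x = 0 → x = 0 := by
    intro i
    induction i with
    | zero =>
      intro _ x hx _
      obtain ⟨z, rfl⟩ := mem_partialSpan.mp hx
      simp
    | succ i ih =>
      intro hi x hx hfx
      obtain ⟨y, hy, z, rfl⟩ := mem_partialSpan_succ.mp hx
      by_cases hz : z ∈ stepIdeal (v ∘ K.b) i
      · exact ih (by omega) _ (add_mem hy (mem_stepIdeal.mp hz)) hfx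
      exfalso
      have hFz : F z ∈ stepIdeal (v' ∘ K.b) i := by
        rw [mem_stepIdeal]
        have h1 : (F z : S) * (v' ∘ K.b) i = - f y := by
          rw [eq_neg_iff_add_eq_zero, add_comm]
          simpa [hF, hf] using hfx
        rw [h1]
        exact neg_mem (hspan i y hy)
      obtain ⟨t, k, hk, hk'⟩ := hp.exists_mul_sub_mem i hi z hz
      have hkS : (k : center S) ∈ stepIdeal (v' ∘ K.b) i := by
        have h1 := hstep i _ hk
        have h2 : (k : center S) = F z * F t - F (z * t - k) := by
          ext; simp [hF]
        rw [h2]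
        exact sub_mem (Ideal.mul_mem_right _ _ hFz) h1
      rcases hk' with rfl | ⟨hT, hk0⟩
      · refine h'.notMem ⟨i, hi⟩ ?_
        simpa [mem_stepIdeal] using hkS
      · have hcode : ∀ j : ℕ,
            NatCode K.D (Ideal.Quotient.mk (stepIdeal (v' ∘ K.b) i) (j : center S)) := by
          intro j
          induction j with
          | zero => simpa using h'.natCode_zero ⟨i, hi⟩ hT
          | succ j ihj => simpa using (h'.natCode_succ ⟨i, hi⟩ hT _ ihj).1
        obtain ⟨j, rfl⟩ := Nat.exists_eq_succ_of_ne_zero hk0.ne'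
        refine (h'.natCode_succ ⟨i, hi⟩ hT _ (hcode j)).2 ?_
        simpa using hkS
  refine ⟨RingEquiv.ofBijective f ⟨?_, hsurj⟩⟩
  rw [injective_iff_map_eq_zero]
  exact fun x => hinj _ le_rfl x (h.mem_top x)

end Coding

section Existence

open Subring

variable {A : Type*} [Ring A] [Module.Finite ℤ A]

theorem moduleFinite_int_center : Module.Finite ℤ (center A) :=
  Module.Finite.of_injective (center A).subtype.toIntAlgHom.toLinearMap Subtype.val_injective

theorem exists_mul_sub_natCast_mem {Z : Type*} [CommRing Z] [Module.Finite ℤ Z] (Q : Ideal Z)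
    [Q.IsPrime] {z : Z} (hz : z ∉ Q) :
    ∃ (y : Z) (k : ℕ), z * y - k ∈ Q ∧ (k = 1 ∨ Infinite (Z ⧸ Q) ∧ 0 < k) := by
  have hz0 : Ideal.Quotient.mk Q z ≠ 0 := fun h => hz (Ideal.Quotient.eq_zero_iff_mem.mp h)
  rcases finite_or_infinite (Z ⧸ Q) with h | h
  · obtain ⟨y, hy⟩ := (Finite.isField_of_domain (Z ⧸ Q)).mul_inv_cancel hz0
    obtain ⟨y, rfl⟩ := Ideal.Quotient.mk_surjective y
    exact ⟨y, 1, Ideal.Quotient.eq.mp (by simpa using hy), Or.inl rfl⟩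
  · have := charZero_of_infinite (O := Z ⧸ Q)
    obtain ⟨k, hk, y, hy⟩ := exists_nat_dvd hz0
    obtain ⟨y, rfl⟩ := Ideal.Quotient.mk_surjective y
    exact ⟨y, k, Ideal.Quotient.eq.mp (by simpa using hy.symm),
      Or.inr ⟨h, Nat.pos_of_ne_zero hk⟩⟩

variable (A) in
/-- A ring whose additive group is finitely generated is presented by a code. -/
theorem exists_ringCode_isPresentation : ∃ (K : RingCode) (v : Fin K.n → A)
    (w : Fin K.m → center A), K.Holds v w ∧ K.IsPresentation v := by
  have hfin := moduleFinite_int_center (A := A)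
  have hnoeth : IsNoetherianRing (center A) := isNoetherian_of_tower ℤ inferInstance
  have hnoeth' : IsNoetherian (center A) A := isNoetherian_of_tower ℤ inferInstance
  have hZ : ∀ I : Ideal (center A), I.IsMaximal → Finite (center A ⧸ I) := fun I hI =>
    have : Module.Finite ℤ (center A ⧸ I) := Module.Finite.of_surjective
      (Ideal.Quotient.mk I).toIntAlgHom.toLinearMap Ideal.Quotient.mk_surjective
    finite_of_isField_of_finiteType_int
      ((Ideal.Quotient.maximal_ideal_iff_isField_quotient I).mp hI)
  have hfinN : Module.Finite ℕ (center A) := by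
    rw [Module.Finite.iff_addMonoid_fg, ← AddGroup.fg_iff_addMonoid_fg,
      ← Module.Finite.iff_addGroup_fg]
    exact hfin
  obtain ⟨n, s, hs⟩ := Module.Finite.exists_fin (R := ℤ) (M := A)
  obtain ⟨m, w, hw⟩ := Module.Finite.exists_fin (R := ℕ) (M := center A)
  obtain ⟨l, a, ha, hprime⟩ := exists_partialSpan_eq_top (R := A)
  let ι := Fin n ⊕ Fin m ⊕ Fin (l + 1)
  let e : ι ≃ Fin (Fintype.card ι) := Fintype.equivFin ι
  let u : ι → A := Sum.elim s (Sum.elim (fun k => (w k : A)) fun i => a i)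
  let v : Fin (Fintype.card ι) → A := u ∘ e.symm
  let b : ℕ → Fin (Fintype.card ι) := fun i => e (.inr (.inr (Fin.ofNat (l + 1) i)))
  have hb : ∀ i ≤ l, (v ∘ b) i = a i := by
    intro i hi
    simp [v, b, u, Nat.mod_eq_of_lt (Nat.lt_succ_iff.mpr hi)]
  have hspan : ∀ i ≤ l, partialSpan (v ∘ b) i = partialSpan a i := fun i hi =>
    partialSpan_congr fun j hj => hb j (hj.le.trans hi)
  have hstep : ∀ i : Fin l, (stepIdeal (v ∘ b) i).IsPrime := fun i => by
    rw [stepIdeal_congr fun j hj => hb j (hj.trans i.2.le)]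
    exact hprime i i.2
  have hv : Submodule.span ℤ (Set.range v) = ⊤ := by
    rw [eq_top_iff, ← hs]
    refine Submodule.span_mono ?_
    rintro _ ⟨k, rfl⟩
    exact ⟨e (.inl k), by simp [v, u]⟩
  have hv' : ∀ x : A, ∃ r : Fin (Fintype.card ι) → ℤ, x = ∑ k, r k • v k := fun x =>
    ((Submodule.mem_span_range_iff_exists_fun ℤ).mp (hv ▸ Submodule.mem_top (x := x))).imp
      fun _ h => h.symm
  choose mul hmul using fun j k => hv' (v j * v k)
  obtain ⟨one, hone⟩ := hv' 1
  obtain ⟨rels, hrels⟩ := IsNoetherian.noetherian (Fintype.linearCombination ℤ v).ker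
  have hrels' : ∀ r : Fin (Fintype.card ι) → ℤ,
      r ∈ Submodule.span ℤ (rels : Set (Fin (Fintype.card ι) → ℤ)) ↔ ∑ k, r k • v k = 0 := by
    intro r
    rw [hrels]
    rfl
  choose D hD using fun i : Fin l => exists_natCode_natCast (stepIdeal (v ∘ b) i)
  let K : RingCode :=
    { n := Fintype.card ι
      m := m
      l := l
      D := Finset.univ.sup D
      b := b
      c := fun k => e (.inr (.inl k))
      T := {i | Infinite (center A ⧸ stepIdeal (v ∘ b) i)}
      rels := rels
      mul := mul
      one := one }
  have hcode : ∀ (i : Fin l) (k : ℕ),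
      NatCode K.D (Ideal.Quotient.mk (stepIdeal (v ∘ b) i) (k : center A)) := fun i k => by
    rw [map_natCast]
    exact hD i _ (Finset.le_sup (Finset.mem_univ i)) k
  refine ⟨K, v, w, ?_, hv, fun r hr => (hrels' r).mpr hr, fun i hi z hz => ?_⟩
  · refine ⟨fun x => ?_, fun k => ?_, fun i x => ?_, fun i hi => ?_, fun i _ => ?_,
      fun i hT x hx => ?_, fun r hr => (hrels' r).mp (Submodule.subset_span hr), hmul, hone⟩
    · show x ∈ partialSpan (v ∘ b) l
      rw [hspan l le_rfl, ha]
      exact Submodule.mem_top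
    · simp [v, u, K]
    · obtain ⟨q, hq⟩ := (Submodule.mem_span_range_iff_exists_fun ℕ).mp
        (hw ▸ Submodule.mem_top (x := x))
      refine ⟨fun k => (q k : center A), fun k => hcode i (q k), ?_⟩
      simp [← hq, nsmul_eq_mul, K]
    · refine (hstep i).ne_top ((Ideal.eq_top_iff_one _).mpr ?_)
      simpa [mem_stepIdeal] using hi
    · simpa using hcode i 0
    · obtain ⟨k, hk⟩ := exists_sub_natCast_mem hZ hx
      have hk' : x + 1 - ((k + 1 : ℕ) : center A) ∈ stepIdeal (v ∘ b) i := by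
        simpa using hk
      refine ⟨?_, fun h1 => ?_⟩
      · show NatCode K.D (Ideal.Quotient.mk (stepIdeal (v ∘ b) i) (x + 1))
        rw [Ideal.Quotient.eq.mpr hk']
        exact hcode i _
      · have h2 := sub_mem h1 hk'
        rw [sub_sub_cancel] at h2
        have h3 := Ideal.Quotient.eq_zero_iff_mem.mpr h2
        rw [map_natCast] at h3
        have : Infinite (center A ⧸ stepIdeal (v ∘ b) i) := hT
        have := charZero_of_infinite (O := center A ⧸ stepIdeal (v ∘ b) i)
        exact Nat.succ_ne_zero k (Nat.cast_eq_zero.mp h3)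
  · have := hstep ⟨i, hi⟩
    exact exists_mul_sub_natCast_mem (stepIdeal (v ∘ b) i) hz

end Existence

section Definability

open Subring

universe w

/-- A ring with elements indexed by `α` and central elements indexed by `β`. -/
structure RingEnv (α β : Type) : Type (w + 1) where
  /-- The underlying ring. -/
  carrier : Type w
  [ring : Ring carrier]
  /-- The elements. -/
  elem : α → carrier
  /-- The central elements. -/
  cen : β → center carrier

attribute [instance] RingEnv.ring

namespace RingEnv

variable {α β γ : Type}

/-- Forget some of the elements. -/
abbrev dropElem (E : RingEnv.{w} (α ⊕ γ) β) : RingEnv.{w} α β :=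
  ⟨E.carrier, E.elem ∘ Sum.inl, E.cen⟩

/-- Forget some of the central elements. -/
abbrev dropCen (E : RingEnv.{w} α (β ⊕ γ)) : RingEnv.{w} α β :=
  ⟨E.carrier, E.elem, E.cen ∘ Sum.inl⟩

/-- The valuation of all variables. -/
def val (E : RingEnv.{w} α β) : α ⊕ β → E.carrier :=
  Sum.elim E.elem fun k => E.cen k

/-- A property is first-order if it is expressed by one formula in all rings. -/
def IsFirstOrder (P : RingEnv.{w} α β → Prop) : Prop :=
  ∃ f : Language.ring.Formula (α ⊕ β),
    ∀ (E : RingEnv.{w} α β) [FirstOrder.Ring.CompatibleRing E.carrier], f.Realize E.val ↔ P E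

/-- A function is a term if it is expressed by one term in all rings. -/
def IsTerm (t : ∀ E : RingEnv.{w} α β, E.carrier) : Prop :=
  ∃ s : Language.ring.Term (α ⊕ β),
    ∀ (E : RingEnv.{w} α β) [FirstOrder.Ring.CompatibleRing E.carrier], s.realize E.val = t E

section Terms

variable {s t : ∀ E : RingEnv.{w} α β, E.carrier}

theorem isTerm_elem (a : α) : IsTerm fun E : RingEnv.{w} α β => E.elem a :=
  ⟨.var (.inl a), fun _ => rfl⟩

theorem isTerm_cen (b : β) : IsTerm fun E : RingEnv.{w} α β => (E.cen b : E.carrier) :=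
  ⟨.var (.inr b), fun _ => rfl⟩

theorem isTerm_zero : IsTerm fun E : RingEnv.{w} α β => (0 : E.carrier) :=
  ⟨0, fun _ => by simp⟩

theorem isTerm_one : IsTerm fun E : RingEnv.{w} α β => (1 : E.carrier) :=
  ⟨1, fun _ => by simp⟩

theorem IsTerm.add (hs : IsTerm s) (ht : IsTerm t) : IsTerm fun E => s E + t E := by
  obtain ⟨s', hs⟩ := hs
  obtain ⟨t', ht⟩ := ht
  exact ⟨s' + t', fun E => by simp [hs, ht]⟩

theorem IsTerm.mul (hs : IsTerm s) (ht : IsTerm t) : IsTerm fun E => s E * t E := by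
  obtain ⟨s', hs⟩ := hs
  obtain ⟨t', ht⟩ := ht
  exact ⟨s' * t', fun E => by simp [hs, ht]⟩

theorem IsTerm.neg (ht : IsTerm t) : IsTerm fun E => -t E := by
  obtain ⟨t', ht⟩ := ht
  exact ⟨-t', fun E => by simp [ht]⟩

theorem IsTerm.sub (hs : IsTerm s) (ht : IsTerm t) : IsTerm fun E => s E - t E := by
  simpa only [sub_eq_add_neg] using hs.add ht.neg

theorem IsTerm.nsmul (n : ℕ) (ht : IsTerm t) : IsTerm fun E => n • t E := by
  induction n with
  | zero => simpa only [zero_smul] using isTerm_zero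
  | succ n ih => simpa only [succ_nsmul] using ih.add ht

theorem IsTerm.zsmul (n : ℤ) (ht : IsTerm t) : IsTerm fun E => n • t E := by
  obtain ⟨k, rfl | rfl⟩ := n.eq_nat_or_neg
  · simpa only [natCast_zsmul] using ht.nsmul k
  · simpa only [neg_smul, natCast_zsmul] using (ht.nsmul k).neg

theorem isTerm_natCast (n : ℕ) : IsTerm fun E : RingEnv.{w} α β => (n : E.carrier) := by
  simpa only [nsmul_one] using isTerm_one.nsmul n

theorem isTerm_sum {ι : Type} (u : Finset ι) {t : ι → ∀ E : RingEnv.{w} α β, E.carrier}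
    (ht : ∀ i, IsTerm (t i)) : IsTerm fun E => ∑ i ∈ u, t i E := by
  classical
  induction u using Finset.induction_on with
  | empty => simpa only [Finset.sum_empty] using isTerm_zero
  | insert i u hi ih => simpa only [Finset.sum_insert hi] using (ht i).add ih

end Terms

section Formulas

variable {P Q : RingEnv.{w} α β → Prop}

theorem isFirstOrder_const (p : Prop) : IsFirstOrder fun _ : RingEnv.{w} α β => p := by
  by_cases hp : p
  · exact ⟨⊤, fun _ => by simp [hp]⟩
  · exact ⟨⊥, fun _ => by simp [hp]⟩

theorem IsTerm.eq {s t : ∀ E : RingEnv.{w} α β, E.carrier} (hs : IsTerm s) (ht : IsTerm t) :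
    IsFirstOrder fun E => s E = t E := by
  obtain ⟨s', hs⟩ := hs
  obtain ⟨t', ht⟩ := ht
  exact ⟨s'.equal t', fun E => by simp [hs, ht]⟩

theorem IsFirstOrder.not (hP : IsFirstOrder P) : IsFirstOrder fun E => ¬ P E := by
  obtain ⟨f, hf⟩ := hP
  exact ⟨∼f, fun E => by simp [hf]⟩

theorem IsFirstOrder.and (hP : IsFirstOrder P) (hQ : IsFirstOrder Q) :
    IsFirstOrder fun E => P E ∧ Q E := by
  obtain ⟨f, hf⟩ := hP
  obtain ⟨g, hg⟩ := hQ
  exact ⟨f ⊓ g, fun E => by simp [hf, hg]⟩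

theorem IsFirstOrder.or (hP : IsFirstOrder P) (hQ : IsFirstOrder Q) :
    IsFirstOrder fun E => P E ∨ Q E := by
  obtain ⟨f, hf⟩ := hP
  obtain ⟨g, hg⟩ := hQ
  exact ⟨f ⊔ g, fun E => by simp [hf, hg]⟩

theorem IsFirstOrder.imp (hP : IsFirstOrder P) (hQ : IsFirstOrder Q) :
    IsFirstOrder fun E => P E → Q E := by
  simpa only [imp_iff_not_or] using hP.not.or hQ

theorem isFirstOrder_exists {ι : Type} [Finite ι] {P : ι → RingEnv.{w} α β → Prop}
    (hP : ∀ i, IsFirstOrder (P i)) : IsFirstOrder fun E => ∃ i, P i E := by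
  choose f hf using hP
  exact ⟨.iSup f, fun E => by simp [hf]⟩

theorem isFirstOrder_forall {ι : Type} [Finite ι] {P : ι → RingEnv.{w} α β → Prop}
    (hP : ∀ i, IsFirstOrder (P i)) : IsFirstOrder fun E => ∀ i, P i E := by
  choose f hf using hP
  exact ⟨.iInf f, fun E => by simp [hf]⟩

theorem isFirstOrder_exists_elem {γ : Type} [Finite γ]
    {P : ∀ E : RingEnv.{w} α β, (γ → E.carrier) → Prop}
    (hP : IsFirstOrder fun E : RingEnv.{w} (α ⊕ γ) β => P E.dropElem (E.elem ∘ Sum.inr)) :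
    IsFirstOrder fun E => ∃ x, P E x := by
  obtain ⟨f, hf⟩ := hP
  let g : (α ⊕ γ) ⊕ β → (α ⊕ β) ⊕ γ :=
    Sum.elim (Sum.map Sum.inl id) (Sum.inl ∘ Sum.inr)
  refine ⟨(f.relabel g).iExs γ, fun E _ => ?_⟩
  rw [Formula.realize_iExs]
  refine exists_congr fun x => ?_
  let F : RingEnv.{w} (α ⊕ γ) β := ⟨E.carrier, Sum.elim E.elem x, E.cen⟩
  have hE : Sum.elim E.val x ∘ g = F.val := by
    ext ((_ | _) | _) <;> rfl
  rw [Formula.realize_relabel, hE]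
  exact hf F

/-- The formula saying that a variable is central. -/
noncomputable def centralFormula (a : α) : Language.ring.Formula α :=
  Formula.iAlls Unit <| Term.equal (.var (.inr ()) * .var (.inl a) : Language.ring.Term (α ⊕ Unit))
    (.var (.inl a) * .var (.inr ()))

theorem realize_centralFormula {R : Type*} [Ring R] [FirstOrder.Ring.CompatibleRing R] {a : α}
    {v : α → R} : (centralFormula a).Realize v ↔ v a ∈ center R := by
  rw [centralFormula, Formula.realize_iAlls, mem_center_iff]
  simp only [Formula.realize_equal, FirstOrder.Ring.realize_mul, Term.realize_var, Sum.elim_inl,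
    Sum.elim_inr]
  exact ⟨fun h g => h fun _ => g, fun h i => h _⟩

theorem isFirstOrder_exists_cen {γ : Type} [Finite γ]
    {P : ∀ E : RingEnv.{w} α β, (γ → center E.carrier) → Prop}
    (hP : IsFirstOrder fun E : RingEnv.{w} α (β ⊕ γ) => P E.dropCen (E.cen ∘ Sum.inr)) :
    IsFirstOrder fun E => ∃ x, P E x := by
  obtain ⟨f, hf⟩ := hP
  let g : α ⊕ (β ⊕ γ) → (α ⊕ β) ⊕ γ := (Equiv.sumAssoc α β γ).symm
  refine ⟨(.iInf (fun k : γ => centralFormula (.inr k)) ⊓ f.relabel g : Language.ring.Formula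
    ((α ⊕ β) ⊕ γ)).iExs γ, fun E _ => ?_⟩
  have key : ∀ x : γ → center E.carrier,
      (f.relabel g).Realize (Sum.elim E.val fun k => (x k : E.carrier)) ↔ P E x := by
    intro x
    let F : RingEnv.{w} α (β ⊕ γ) := ⟨E.carrier, E.elem, Sum.elim E.cen x⟩
    have hE : (Sum.elim E.val fun k => (x k : E.carrier)) ∘ g = F.val := by
      ext (_ | (_ | _)) <;> rfl
    rw [Formula.realize_relabel, hE]
    exact hf F
  simp only [Formula.realize_iExs, Formula.realize_inf, Formula.realize_iInf,
    realize_centralFormula, Sum.elim_inr]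
  constructor
  · rintro ⟨x, hx, h⟩
    exact ⟨fun k => ⟨x k, hx k⟩, (key _).mp h⟩
  · rintro ⟨x, h⟩
    exact ⟨fun k => x k, fun k => (x k).2, (key x).mpr h⟩

end Formulas

theorem IsTerm.dropElem {t : ∀ E : RingEnv.{w} α β, E.carrier} (ht : IsTerm t) :
    IsTerm fun E : RingEnv.{w} (α ⊕ γ) β => t E.dropElem := by
  obtain ⟨s, hs⟩ := ht
  refine ⟨s.relabel (Sum.map Sum.inl id), fun E _ => ?_⟩
  have hE : E.val ∘ Sum.map Sum.inl id = E.dropElem.val := by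
    ext (_ | _) <;> rfl
  rw [Term.realize_relabel, hE]
  exact hs E.dropElem

theorem IsTerm.dropCen {t : ∀ E : RingEnv.{w} α β, E.carrier} (ht : IsTerm t) :
    IsTerm fun E : RingEnv.{w} α (β ⊕ γ) => t E.dropCen := by
  obtain ⟨s, hs⟩ := ht
  refine ⟨s.relabel (Sum.map id Sum.inl), fun E _ => ?_⟩
  have hE : E.val ∘ Sum.map id Sum.inl = E.dropCen.val := by
    ext (_ | _) <;> rfl
  rw [Term.realize_relabel, hE]
  exact hs E.dropCen

theorem isFirstOrder_exists_cen_unit {P : ∀ E : RingEnv.{w} α β, center E.carrier → Prop}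
    (hP : IsFirstOrder fun E : RingEnv.{w} α (β ⊕ Unit) => P E.dropCen (E.cen (Sum.inr ()))) :
    IsFirstOrder fun E => ∃ x, P E x := by
  have := isFirstOrder_exists_cen (γ := Unit) (P := fun E x => P E (x ())) hP
  have h : ∀ E : RingEnv.{w} α β, (∃ x : Unit → center E.carrier, P E (x ())) ↔ ∃ x, P E x :=
    fun E => ⟨fun ⟨x, hx⟩ => ⟨x (), hx⟩, fun ⟨x, hx⟩ => ⟨fun _ => x, hx⟩⟩
  simpa only [h] using this

theorem isFirstOrder_forall_cen_unit {P : ∀ E : RingEnv.{w} α β, center E.carrier → Prop}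
    (hP : IsFirstOrder fun E : RingEnv.{w} α (β ⊕ Unit) => P E.dropCen (E.cen (Sum.inr ()))) :
    IsFirstOrder fun E => ∀ x, P E x := by
  simpa only [not_exists, not_not] using
    (isFirstOrder_exists_cen_unit (P := fun E x => ¬ P E x) hP.not).not

theorem isFirstOrder_forall_elem_unit {P : ∀ E : RingEnv.{w} α β, E.carrier → Prop}
    (hP : IsFirstOrder fun E : RingEnv.{w} (α ⊕ Unit) β => P E.dropElem (E.elem (Sum.inr ()))) :
    IsFirstOrder fun E => ∀ x, P E x := by
  have := (isFirstOrder_exists_elem (γ := Unit) (P := fun E x => ¬ P E (x ())) hP.not).not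
  have h : ∀ E : RingEnv.{w} α β, (¬ ∃ x : Unit → E.carrier, ¬ P E (x ())) ↔ ∀ x, P E x :=
    fun E => ⟨fun h x => by_contra fun hx => h ⟨fun _ => x, hx⟩, fun h ⟨x, hx⟩ => hx (h _)⟩
  simpa only [h] using this

theorem IsTerm.mem_partialSpan (b : ℕ → α) (i : ℕ) {t : ∀ E : RingEnv.{w} α β, E.carrier}
    (ht : IsTerm t) : IsFirstOrder fun E => t E ∈ partialSpan (E.elem ∘ b) i := by
  simp only [_root_.mem_partialSpan]
  refine isFirstOrder_exists_cen
    (P := fun E z => ∑ j : Fin i, (z j : E.carrier) * (E.elem ∘ b) j = t E) ?_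
  exact (isTerm_sum _ fun j => (isTerm_cen _).mul (isTerm_elem _)).eq ht.dropCen

theorem IsTerm.mem_stepIdeal (b : ℕ → α) (i : ℕ) {t : ∀ E : RingEnv.{w} α β, center E.carrier}
    (ht : IsTerm fun E => (t E : E.carrier)) :
    IsFirstOrder fun E => t E ∈ stepIdeal (E.elem ∘ b) i := by
  simp only [_root_.mem_stepIdeal]
  exact (ht.mul (isTerm_elem (b i))).mem_partialSpan b i

section Quotient

variable {b : ℕ → α} {i : ℕ}

/-- A function to the quotients by a step ideal is a term if it is expressed by a term. -/
def IsQuotTerm (t : ∀ E : RingEnv.{w} α β, center E.carrier ⧸ stepIdeal (E.elem ∘ b) i) : Prop :=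
  ∃ s : ∀ E : RingEnv.{w} α β, center E.carrier, IsTerm (fun E => (s E : E.carrier)) ∧
    ∀ E, Ideal.Quotient.mk _ (s E) = t E

variable {s t x u v : ∀ E : RingEnv.{w} α β, center E.carrier ⧸ stepIdeal (E.elem ∘ b) i}

theorem IsTerm.isQuotTerm {s : ∀ E : RingEnv.{w} α β, center E.carrier}
    (hs : IsTerm (fun E => (s E : E.carrier))) :
    IsQuotTerm (b := b) (i := i) fun E => Ideal.Quotient.mk _ (s E) :=
  ⟨s, hs, fun _ => rfl⟩

theorem IsQuotTerm.add (hs : IsQuotTerm s) (ht : IsQuotTerm t) :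
    IsQuotTerm fun E => s E + t E := by
  obtain ⟨s', hs', hs⟩ := hs
  obtain ⟨t', ht', ht⟩ := ht
  exact ⟨fun E => s' E + t' E, hs'.add ht', fun E => by rw [map_add, hs, ht]⟩

theorem IsQuotTerm.sub (hs : IsQuotTerm s) (ht : IsQuotTerm t) :
    IsQuotTerm fun E => s E - t E := by
  obtain ⟨s', hs', hs⟩ := hs
  obtain ⟨t', ht', ht⟩ := ht
  exact ⟨fun E => s' E - t' E, hs'.sub ht', fun E => by rw [map_sub, hs, ht]⟩

theorem IsQuotTerm.mul (hs : IsQuotTerm s) (ht : IsQuotTerm t) :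
    IsQuotTerm fun E => s E * t E := by
  obtain ⟨s', hs', hs⟩ := hs
  obtain ⟨t', ht', ht⟩ := ht
  exact ⟨fun E => s' E * t' E, hs'.mul ht', fun E => by rw [map_mul, hs, ht]⟩

theorem isQuotTerm_zero : IsQuotTerm fun E : RingEnv.{w} α β =>
    (0 : center E.carrier ⧸ stepIdeal (E.elem ∘ b) i) :=
  ⟨fun _ => 0, isTerm_zero, fun _ => map_zero _⟩

theorem isQuotTerm_one : IsQuotTerm fun E : RingEnv.{w} α β =>
    (1 : center E.carrier ⧸ stepIdeal (E.elem ∘ b) i) :=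
  ⟨fun _ => 1, isTerm_one, fun _ => map_one _⟩

theorem isQuotTerm_natCast (n : ℕ) : IsQuotTerm fun E : RingEnv.{w} α β =>
    (n : center E.carrier ⧸ stepIdeal (E.elem ∘ b) i) :=
  ⟨fun _ => n, by simpa using isTerm_natCast n, fun _ => map_natCast _ n⟩

theorem IsQuotTerm.eq (hs : IsQuotTerm s) (ht : IsQuotTerm t) :
    IsFirstOrder fun E => s E = t E := by
  obtain ⟨s', hs', hs⟩ := hs
  obtain ⟨t', ht', ht⟩ := ht
  simp only [← hs, ← ht, Ideal.Quotient.eq]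
  exact IsTerm.mem_stepIdeal b i (hs'.sub ht')

theorem IsQuotTerm.dropCen (ht : IsQuotTerm t) :
    IsQuotTerm (b := b) (i := i) fun E : RingEnv.{w} α (β ⊕ γ) => t E.dropCen := by
  obtain ⟨t', ht', ht⟩ := ht
  exact ⟨fun E => t' E.dropCen, ht'.dropCen, fun E => ht E.dropCen⟩

theorem isFirstOrder_exists_quot
    {P : ∀ E : RingEnv.{w} α β, (center E.carrier ⧸ stepIdeal (E.elem ∘ b) i) → Prop}
    (hP : ∀ t : ∀ E : RingEnv.{w} α (β ⊕ Unit), center E.carrier ⧸ stepIdeal (E.elem ∘ b) i,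
      IsQuotTerm t → IsFirstOrder fun E => P E.dropCen (t E)) :
    IsFirstOrder fun E => ∃ x, P E x := by
  simp only [Ideal.Quotient.mk_surjective.exists]
  exact isFirstOrder_exists_cen_unit
    (P := fun E x => P E (Ideal.Quotient.mk _ x)) (hP _ (isTerm_cen (Sum.inr ())).isQuotTerm)

theorem isFirstOrder_forall_quot
    {P : ∀ E : RingEnv.{w} α β, (center E.carrier ⧸ stepIdeal (E.elem ∘ b) i) → Prop}
    (hP : ∀ t : ∀ E : RingEnv.{w} α (β ⊕ Unit), center E.carrier ⧸ stepIdeal (E.elem ∘ b) i,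
      IsQuotTerm t → IsFirstOrder fun E => P E.dropCen (t E)) :
    IsFirstOrder fun E => ∀ x, P E x := by
  simpa only [not_exists, not_not] using
    (isFirstOrder_exists_quot (P := fun E x => ¬ P E x) fun t ht => (hP t ht).not).not

/-- The property `u ∣ x * v` of quotient terms is first-order. -/
theorem IsQuotTerm.exists_mul_eq (hu : IsQuotTerm u) (hv : IsQuotTerm v) (hx : IsQuotTerm x) :
    IsFirstOrder fun E => ∃ y, x E * v E = u E * y := by
  refine isFirstOrder_exists_quot (P := fun E y => x E * v E = u E * y) fun t ht => ?_
  exact (hx.dropCen.mul hv.dropCen).eq (hu.dropCen.mul ht)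

theorem IsQuotTerm.forall_dvd_and_not_coprime (D : ℕ) (hu : IsQuotTerm u) (hv : IsQuotTerm v)
    (ht : IsQuotTerm t) (hx : IsQuotTerm x) :
    IsFirstOrder fun E => (∀ k : Fin D, ∃ y, (x E + ((k : ℕ) + 1)) * y = u E) ∧
      ¬ ∃ a c, a * (1 + (x E + 1) * v E) + c * t E = 1 := by
  refine (isFirstOrder_forall fun k => isFirstOrder_exists_quot fun y hy => ?_).and
    (isFirstOrder_exists_quot fun a ha => isFirstOrder_exists_quot fun c hc => ?_).not
  · exact ((hx.dropCen.add ((isQuotTerm_natCast _).add isQuotTerm_one)).mul hy).eq hu.dropCen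
  · exact ((ha.dropCen.mul (isQuotTerm_one.add
      ((hx.dropCen.dropCen.add isQuotTerm_one).mul hv.dropCen.dropCen))).add
      (hc.mul ht.dropCen.dropCen)).eq isQuotTerm_one

theorem IsQuotTerm.natCode (D : ℕ) {n : ∀ E : RingEnv.{w} α β,
      center E.carrier ⧸ stepIdeal (E.elem ∘ b) i} (hn : IsQuotTerm n) :
    IsFirstOrder fun E => NatCode D (n E) := by
  unfold NatCode
  dsimp only
  refine (isFirstOrder_exists fun k => hn.eq (isQuotTerm_natCast _)).or ?_
  refine isFirstOrder_exists_quot fun u hu => ?_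
  refine isFirstOrder_exists_quot fun v hv => ?_
  refine isFirstOrder_exists_quot fun f hf => ?_
  refine isFirstOrder_exists_quot fun g hg => ?_
  refine isFirstOrder_exists_quot fun h hh => ?_
  replace hn := hn.dropCen (γ := Unit) |>.dropCen (γ := Unit) |>.dropCen (γ := Unit)
    |>.dropCen (γ := Unit) |>.dropCen (γ := Unit)
  replace hu := hu.dropCen (γ := Unit) |>.dropCen (γ := Unit) |>.dropCen (γ := Unit)
    |>.dropCen (γ := Unit)
  replace hv := hv.dropCen (γ := Unit) |>.dropCen (γ := Unit) |>.dropCen (γ := Unit)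
  replace hf := hf.dropCen (γ := Unit) |>.dropCen (γ := Unit)
  replace hg := hg.dropCen (γ := Unit)
  refine (hu.exists_mul_eq hv isQuotTerm_one).not.and (.and ?_ (.and ?_ (.and ?_ ?_)))
  · refine isFirstOrder_forall_quot fun x hx => ?_
    refine (hu.dropCen.exists_mul_eq hv.dropCen hx).or (isFirstOrder_exists_quot fun y hy => ?_)
    exact hu.dropCen.dropCen.exists_mul_eq hv.dropCen.dropCen
      ((hx.dropCen.mul hy).sub isQuotTerm_one)
  · exact hf.forall_dvd_and_not_coprime D hg hh isQuotTerm_zero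
  · refine isFirstOrder_forall_quot fun x hx => ?_
    have hS {x} := hf.dropCen (γ := Unit).forall_dvd_and_not_coprime D (x := x)
      hg.dropCen hh.dropCen
    exact (hS hx).imp (((hx.eq hn.dropCen).or (hS (hx.add isQuotTerm_one))).and
      ((hx.add isQuotTerm_one).eq isQuotTerm_zero).not)
  · refine isFirstOrder_forall_quot fun x hx => ?_
    refine isFirstOrder_forall_quot fun y hy => ?_
    have hS {x} := hf.dropCen (γ := Unit).dropCen (γ := Unit).forall_dvd_and_not_coprime D (x := x)
      hg.dropCen.dropCen hh.dropCen.dropCen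
    exact (hS hx.dropCen).imp ((hS hy).imp ((hu.dropCen.dropCen.exists_mul_eq
      hv.dropCen.dropCen (hx.dropCen.sub hy)).imp (hx.dropCen.eq hy)))

end Quotient

end RingEnv

end Definability

section Sentence

open Subring RingEnv

universe w

theorem RingCode.holds_iff {K : RingCode} {R : Type*} [Ring R] {v : Fin K.n → R}
    {w : Fin K.m → center R} : K.Holds v w ↔
    (∀ x : R, x ∈ partialSpan (v ∘ K.b) K.l) ∧
    (∀ k, (w k : R) = v (K.c k)) ∧
    (∀ (i : Fin K.l) (x : center R), ∃ z : Fin K.m → center R,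
      (∀ k, NatCode K.D (Ideal.Quotient.mk (stepIdeal (v ∘ K.b) i) (z k))) ∧
        x - ∑ k, z k * w k ∈ stepIdeal (v ∘ K.b) i) ∧
    (∀ i : Fin K.l, ¬ v (K.b i) ∈ partialSpan (v ∘ K.b) i) ∧
    (∀ i : Fin K.l, ↑i ∈ K.T → NatCode K.D (Ideal.Quotient.mk (stepIdeal (v ∘ K.b) i) 0)) ∧
    (∀ i : Fin K.l, ↑i ∈ K.T → ∀ x : center R,
      NatCode K.D (Ideal.Quotient.mk (stepIdeal (v ∘ K.b) i) x) →
        NatCode K.D (Ideal.Quotient.mk (stepIdeal (v ∘ K.b) i) (x + 1)) ∧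
          ¬ x + 1 ∈ stepIdeal (v ∘ K.b) i) ∧
    (∀ r : K.rels, ∑ k, r.1 k • v k = 0) ∧
    (∀ j k, v j * v k = ∑ i, K.mul j k i • v i) ∧
    (1 : R) = ∑ i, K.one i • v i :=
  ⟨fun ⟨h1, h2, h3, h4, h5, h6, h7, h8, h9⟩ =>
      ⟨h1, h2, h3, h4, h5, h6, fun r => h7 r.1 r.2, h8, h9⟩,
    fun ⟨h1, h2, h3, h4, h5, h6, h7, h8, h9⟩ =>
      ⟨h1, h2, h3, h4, h5, h6, fun r hr => h7 ⟨r, hr⟩, h8, h9⟩⟩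

theorem RingCode.isFirstOrder_holds (K : RingCode) {α β : Type} (v : Fin K.n → α)
    (w : Fin K.m → β) :
    IsFirstOrder fun E : RingEnv.{w} α β => K.Holds (E.elem ∘ v) (E.cen ∘ w) := by
  simp only [RingCode.holds_iff]
  refine .and ?_ (.and ?_ (.and ?_ (.and ?_ (.and ?_ (.and ?_ (.and ?_ (.and ?_ ?_)))))))
  · exact isFirstOrder_forall_elem_unit
      ((isTerm_elem (Sum.inr ())).mem_partialSpan (Sum.inl ∘ v ∘ K.b) K.l)
  · exact isFirstOrder_forall fun k => (isTerm_cen _).eq (isTerm_elem _)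
  · refine isFirstOrder_forall fun i => isFirstOrder_forall_cen_unit (isFirstOrder_exists_cen ?_)
    refine .and (isFirstOrder_forall fun k => ?_) ?_
    · exact (IsTerm.isQuotTerm (b := v ∘ K.b) (isTerm_cen (Sum.inr k))).natCode K.D
    · refine IsTerm.mem_stepIdeal (v ∘ K.b) i ?_
      have : IsTerm fun E : RingEnv.{w} α ((β ⊕ Unit) ⊕ Fin K.m) =>
          (E.cen (.inl (.inr ())) : E.carrier) -
            ∑ k, (E.cen (.inr k) : E.carrier) * E.cen (.inl (.inl (w k))) :=
        (isTerm_cen _).sub (isTerm_sum _ fun k => (isTerm_cen _).mul (isTerm_cen _))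
      simpa using this
  · exact isFirstOrder_forall fun i => ((isTerm_elem _).mem_partialSpan (v ∘ K.b) i).not
  · refine isFirstOrder_forall fun i => (isFirstOrder_const _).imp ?_
    exact (IsTerm.isQuotTerm (b := v ∘ K.b) (s := fun _ => 0) isTerm_zero).natCode K.D
  · refine isFirstOrder_forall fun i => (isFirstOrder_const _).imp
      (isFirstOrder_forall_cen_unit (.imp ?_ (.and ?_ (.not ?_))))
    · exact (IsTerm.isQuotTerm (b := v ∘ K.b) (isTerm_cen (Sum.inr ()))).natCode K.D
    · exact (IsTerm.isQuotTerm (b := v ∘ K.b) (s := fun E => E.cen (Sum.inr ()) + 1)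
        ((isTerm_cen _).add isTerm_one)).natCode K.D
    · exact IsTerm.mem_stepIdeal (t := fun E => E.cen (Sum.inr ()) + 1) (v ∘ K.b) i
        ((isTerm_cen _).add isTerm_one)
  · exact isFirstOrder_forall fun r =>
      (isTerm_sum _ fun k => (isTerm_elem _).zsmul _).eq isTerm_zero
  · exact isFirstOrder_forall fun j => isFirstOrder_forall fun k =>
      ((isTerm_elem _).mul (isTerm_elem _)).eq (isTerm_sum _ fun i => (isTerm_elem _).zsmul _)
  · exact isTerm_one.eq (isTerm_sum _ fun i => (isTerm_elem _).zsmul _)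

/-- The conditions of a code are expressed by a sentence. -/
theorem RingCode.exists_sentence (K : RingCode) : ∃ f : Language.ring.Sentence,
    ∀ (R : Type w) [Ring R] [FirstOrder.Ring.CompatibleRing R],
      R ⊨ f ↔ ∃ (v : Fin K.n → R) (w : Fin K.m → center R), K.Holds v w := by
  have : IsFirstOrder fun E : RingEnv.{w} Empty Empty =>
      ∃ (v : Fin K.n → E.carrier) (w : Fin K.m → center E.carrier), K.Holds v w :=
    isFirstOrder_exists_elem (isFirstOrder_exists_cen (K.isFirstOrder_holds Sum.inr Sum.inr))
  obtain ⟨f, hf⟩ := this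
  refine ⟨f.relabel (Sum.elim id id), fun R _ _ => ?_⟩
  let E : RingEnv.{w} Empty Empty := ⟨R, Empty.elim, Empty.elim⟩
  refine Iff.trans ?_ (hf E)
  rw [Sentence.Realize, Formula.realize_relabel]
  have : (default : Empty → R) ∘ Sum.elim id id = E.val := by
    ext (x | x) <;> exact x.elim
  rw [this]

theorem realize_sentence_ringEquiv {R S : Type*} [Ring R] [Ring S]
    [FirstOrder.Ring.CompatibleRing R] [FirstOrder.Ring.CompatibleRing S] (e : R ≃+* S)
    (f : Language.ring.Sentence) : R ⊨ f ↔ S ⊨ f :=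
  (FirstOrder.Ring.languageEquivEquivRingEquiv.symm e).toElementaryEmbedding.map_sentence f

theorem exists_finset_closure_eq_top_of_ringEquiv {R S : Type*} [Ring R] [Ring S] (e : R ≃+* S)
    (h : ∃ s : Finset R, Subring.closure (s : Set R) = ⊤) :
    ∃ s : Finset S, Subring.closure (s : Set S) = ⊤ := by
  classical
  obtain ⟨s, hs⟩ := h
  refine ⟨s.image e, ?_⟩
  rw [Finset.coe_image]
  refine (RingHom.map_closure (e : R →+* S) _).symm.trans ?_
  rw [hs, ← RingHom.range_eq_map]
  exact RingHom.range_eq_top.mpr e.surjective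

/-- A ring whose additive group is finitely generated is determined among the finitely generated
rings by a first-order sentence. -/
theorem exists_sentence_forall_nonempty_ringEquiv.{v} (A : Type v) [Ring A] [Module.Finite ℤ A]
    [FirstOrder.Ring.CompatibleRing A] :
    ∃ f : Language.ring.Sentence, A ⊨ f ∧
      ∀ (B : Type u) [Ring B] [FirstOrder.Ring.CompatibleRing B],
        (∃ s : Finset B, Subring.closure (s : Set B) = ⊤) → B ⊨ f → Nonempty (A ≃+* B) := by
  obtain ⟨K, v, w, h, hp⟩ := exists_ringCode_isPresentation (ULift.{u} A)
  obtain ⟨f, hf⟩ := K.exists_sentence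
  refine ⟨f, ?_, fun B _ _ hB hBf => ?_⟩
  · let _ := FirstOrder.Ring.compatibleRingOfRing (ULift.{u} A)
    exact (realize_sentence_ringEquiv ULift.ringEquiv f).mp ((hf _).mpr ⟨v, w, h⟩)
  · let _ := FirstOrder.Ring.compatibleRingOfRing (ULift.{v} B)
    obtain ⟨v', w', h'⟩ := (hf (ULift.{v} B)).mp
      ((realize_sentence_ringEquiv ULift.ringEquiv f).mpr hBf)
    obtain ⟨e⟩ := hp.nonempty_ringEquiv h h'
      (exists_finset_closure_eq_top_of_ringEquiv ULift.ringEquiv.symm hB)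
    exact ⟨ULift.ringEquiv.symm.trans (e.trans ULift.ringEquiv)⟩

end Sentence

theorem stmt_6 (A : Type*) [Ring A] [Module.Finite ℤ A]
    [FirstOrder.Ring.CompatibleRing A] :
    ∃ φ : Language.ring.Sentence,
      (A ⊨ φ) ∧
        ∀ (B : Type u) [Ring B] [FirstOrder.Ring.CompatibleRing B],
          (∃ s : Finset B, Subring.closure (s : Set B) = ⊤) →
          (B ⊨ φ) → Nonempty (A ≃+* B) :=
  exists_sentence_forall_nonempty_ringEquiv A
end

section
/- Let A be a ring (an abelian group with a ℤ-bilinear multiplication, not necessarily associative, commutative, or unital) whose additive group is generated by elements a₁, …, aₙ. Then every element of A² (the additive subgroup of A generated by all products x*y) can be written in the form a₁z₁ + ⋯ + aₙzₙ for some z₁, …, zₙ ∈ A; in particular, every element of A² is a sum of at most n products. -/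
/-- The additive subgroup of all sums `∑ i, a i * z i`. -/
def rightCombinations {A ι : Type*} [NonUnitalNonAssocRing A] [Fintype ι] (a : ι → A) :
    AddSubgroup A where
  carrier := {w | ∃ z : ι → A, w = ∑ i, a i * z i}
  zero_mem' := ⟨0, by simp⟩
  add_mem' := by
    rintro _ _ ⟨z, rfl⟩ ⟨z', rfl⟩
    exact ⟨z + z', by simp [mul_add, Finset.sum_add_distrib]⟩
  neg_mem' := by
    rintro _ ⟨z, rfl⟩
    exact ⟨-z, by simp⟩

theorem mul_mem_rightCombinations {A ι : Type*} [NonUnitalNonAssocRing A] [Fintype ι]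
    {a : ι → A} {x : A} (hx : x ∈ AddSubgroup.closure (Set.range a)) (y : A) :
    x * y ∈ rightCombinations a := by
  classical
  induction hx using AddSubgroup.closure_induction with
  | mem x hx =>
    obtain ⟨i, rfl⟩ := hx
    refine ⟨Pi.single i y, ?_⟩
    rw [Finset.sum_eq_single i] <;> simp +contextual
  | zero => simp
  | add x x' _ _ h h' => simpa [add_mul] using add_mem h h'
  | neg x _ h => simpa using h

theorem stmt_8 (A : Type*) [NonUnitalNonAssocRing A] (n : ℕ) (a : Fin n → A)
    (hgen : AddSubgroup.closure (Set.range a) = ⊤)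
    (w : A) (hw : w ∈ AddSubgroup.closure {z : A | ∃ x y : A, z = x * y}) :
    ∃ z : Fin n → A, w = ∑ i, a i * z i := by
  suffices h : AddSubgroup.closure {z : A | ∃ x y : A, z = x * y} ≤ rightCombinations a from h hw
  rw [AddSubgroup.closure_le]
  rintro _ ⟨x, y, rfl⟩
  exact mul_mem_rightCombinations (hgen ▸ AddSubgroup.mem_top x) y
end

section
/- Let A be a ring (an abelian group with a ℤ-bilinear multiplication, not necessarily associative, commutative, or unital) that is finitely generated as a ℤ-module, let I be a set, and let u be an ultrafilter on I. Then there is a ℤ-linear equivalence e : A ⊗[ℤ] (ℤ*) → A*, where ℤ* and A* denote the ultrapowers Filter.Germ (↑u) ℤ and Filter.Germ (↑u) A, such that e sends a ⊗ₜ (germ of f) to the germ of i ↦ f(i) • a, e sends a ⊗ₜ 1 to the diagonal image of a, and e is multiplicative on pure tensors: e(a ⊗ₜ x) * e(b ⊗ₜ y) = e((a*b) ⊗ₜ (x*y)) for all a, b ∈ A and x, y ∈ ℤ*. -/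
open TensorProduct Filter

namespace Filter.Germ

variable {α R M : Type*} {l : Filter α} [CommRing R] [AddCommGroup M] [Module R M]

theorem coe_finset_sum {ι N : Type*} [AddCommMonoid N] (s : Finset ι) (f : ι → α → N) :
    (↑(∑ j ∈ s, f j) : Germ l N) = ∑ j ∈ s, (↑(f j) : Germ l N) :=
  map_sum (coeAddHom l) f s

variable (R M l) in
/-- The canonical map `M ⊗ R* → M*` sending `m ⊗ₜ ↑f` to the germ of `i ↦ f i • m`. -/
def tensorToGerm : M ⊗[R] Germ l R →ₗ[R] Germ l M :=
  TensorProduct.lift <| LinearMap.mk₂ R (fun m x => x.map (· • m))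
    (fun m n x => x.inductionOn fun f => congrArg ofFun <| funext fun i => smul_add (f i) m n)
    (fun c m x => x.inductionOn fun f => congrArg ofFun <| funext fun i => smul_comm (f i) c m)
    (fun m x y => inductionOn₂ x y fun f g =>
      congrArg ofFun <| funext fun i => add_smul (f i) (g i) m)
    (fun c m x => x.inductionOn fun f =>
      congrArg ofFun <| funext fun i => smul_assoc c (f i) m)

@[simp]
theorem tensorToGerm_tmul_coe (m : M) (f : α → R) :
    tensorToGerm R M l (m ⊗ₜ[R] (↑f : Germ l R)) = (↑(fun i => f i • m) : Germ l M) :=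
  rfl

theorem tensorToGerm_sum {ι : Type*} [Fintype ι] (m : ι → M) (f : ι → α → R) :
    tensorToGerm R M l (∑ j, m j ⊗ₜ[R] (↑(f j) : Germ l R)) =
      (↑(fun i => ∑ j, f j i • m j) : Germ l M) := by
  rw [map_sum]
  simp only [tensorToGerm_tmul_coe]
  rw [← coe_finset_sum]
  congr 1
  ext i
  simp

theorem tensorToGerm_surjective [Module.Finite R M] :
    Function.Surjective (tensorToGerm R M l) := by
  obtain ⟨n, m, hm⟩ := Module.Finite.exists_fin (R := R) (M := M)
  intro y
  induction y using inductionOn with | _ g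
  have hg i : ∃ c : Fin n → R, ∑ j, c j • m j = g i :=
    Submodule.mem_span_range_iff_exists_fun R |>.mp (hm ▸ Submodule.mem_top)
  choose c hc using hg
  refine ⟨∑ j, m j ⊗ₜ[R] (↑(fun i => c i j) : Germ l R), ?_⟩
  rw [tensorToGerm_sum]
  exact congrArg ofFun (funext hc)

/-- A linear relation among the `m j` holding along `l` has coefficients in the finitely generated
module of relations, so the corresponding tensor vanishes trivially. -/
theorem tensorToGerm_injective [IsNoetherianRing R] :
    Function.Injective (tensorToGerm R M l) := by
  refine (injective_iff_map_eq_zero _).mpr fun x hx => ?_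
  obtain ⟨k, m, y, rfl⟩ := TensorProduct.exists_sum_tmul_eq x
  have hy j : ∃ f : α → R, (↑f : Germ l R) = y j := (y j).inductionOn fun f => ⟨f, rfl⟩
  choose f hf using hy
  obtain rfl : (fun j => (↑(f j) : Germ l R)) = y := funext hf
  rw [tensorToGerm_sum] at hx
  have hx0 : ∀ᶠ i in l, ∑ j, f j i • m j = 0 := coe_eq.mp hx
  obtain ⟨n, s, hs⟩ := Submodule.fg_iff_exists_fin_generating_family.mp
    (IsNoetherian.noetherian (LinearMap.ker (Fintype.linearCombination R m)))
  have hmem i : ∃ c : Fin n → R, ∑ j, f j i • m j = 0 → ∑ t, c t • s t = fun j => f j i := by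
    by_cases h : ∑ j, f j i • m j = 0
    · have hker : (fun j => f j i) ∈ LinearMap.ker (Fintype.linearCombination R m) := by
        simpa [Fintype.linearCombination_apply] using h
      rw [← hs] at hker
      obtain ⟨c, hc⟩ := (Submodule.mem_span_range_iff_exists_fun R).mp hker
      exact ⟨c, fun _ => hc⟩
    · exact ⟨0, fun h' => absurd h' h⟩
  choose c hc using hmem
  refine TensorProduct.sum_tmul_eq_zero_of_vanishesTrivially R
    ⟨n, fun j t => s t j, fun t => (↑(fun i => c i t) : Germ l R), fun j => ?_, fun t => ?_⟩
  · simp only [← coe_smul]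
    rw [← coe_finset_sum]
    refine coe_eq.mpr ?_
    filter_upwards [hx0] with i hi
    simpa [mul_comm] using (congrFun (hc i hi) j).symm
  · have hst : s t ∈ LinearMap.ker (Fintype.linearCombination R m) :=
      hs ▸ Submodule.subset_span ⟨t, rfl⟩
    simpa [Fintype.linearCombination_apply] using hst

end Filter.Germ

theorem stmt_9 (A : Type*) [NonUnitalNonAssocRing A] [Module.Finite ℤ A]
    (I : Type*) (u : Ultrafilter I) :
    ∃ e : (A ⊗[ℤ] Germ (↑u : Filter I) ℤ) ≃ₗ[ℤ] Germ (↑u : Filter I) A,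
      (∀ (a : A) (f : I → ℤ),
          e (a ⊗ₜ[ℤ] (↑f : Germ (↑u : Filter I) ℤ)) =
            (↑(fun i => f i • a) : Germ (↑u : Filter I) A)) ∧
      (∀ a : A, e (a ⊗ₜ[ℤ] 1) = (↑a : Germ (↑u : Filter I) A)) ∧
      (∀ (a b : A) (x y : Germ (↑u : Filter I) ℤ),
        e (a ⊗ₜ[ℤ] x) * e (b ⊗ₜ[ℤ] y) = e ((a * b) ⊗ₜ[ℤ] (x * y))) := by
  let e : (A ⊗[ℤ] Germ (↑u : Filter I) ℤ) ≃ₗ[ℤ] Germ (↑u : Filter I) A :=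
    LinearEquiv.ofBijective (Germ.tensorToGerm ℤ A (↑u : Filter I))
      ⟨Germ.tensorToGerm_injective, Germ.tensorToGerm_surjective⟩
  have he (a : A) (f : I → ℤ) : e (a ⊗ₜ[ℤ] (↑f : Germ (↑u : Filter I) ℤ)) =
      (↑(fun i => f i • a) : Germ (↑u : Filter I) A) := rfl
  refine ⟨e, he, fun a => ?_, fun a b x y => ?_⟩
  · exact (he a 1).trans (congrArg Germ.ofFun (funext fun _ => one_smul ℤ a))
  · induction x, y using Germ.inductionOn₂ with | _ f g
    rw [← Germ.coe_mul, he, he, he, ← Germ.coe_mul]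
    exact congrArg Germ.ofFun (funext fun i => smul_mul_smul_comm (f i) a (g i) b)
end

section
/- Let A be a ring (an abelian group with a ℤ-bilinear multiplication, not necessarily associative, commutative, or unital), let I be a set, let u be an ultrafilter on I, and let f : I → A. Then the germ of f lies in the annihilator Ann(A*) of the ultrapower A* = Filter.Germ (↑u) A if and only if the set {i ∈ I | f(i) ∈ Ann(A)} belongs to u. -/
open Filter

/-- The two-sided annihilator of a (not necessarily associative/unital) ring,
as a set: `{x | x*y = 0 ∧ y*x = 0 for all y}`. -/
def annSet (A : Type*) [NonUnitalNonAssocRing A] : Set A :=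
  {x : A | ∀ y : A, x * y = 0 ∧ y * x = 0}

theorem stmt_10 (A : Type*) [NonUnitalNonAssocRing A]
    (I : Type*) (u : Ultrafilter I) (f : I → A) :
    (↑f : Germ (↑u : Filter I) A) ∈ annSet (Germ (↑u : Filter I) A) ↔
      {i : I | f i ∈ annSet A} ∈ u := by
  constructor
  · intro h
    have key : ∀ i, ∃ y, f i * y = 0 ∧ y * f i = 0 → f i ∈ annSet A := fun i => by
      by_cases hi : f i ∈ annSet A
      · exact ⟨0, fun _ => hi⟩
      · obtain ⟨y, hy⟩ := not_forall.mp hi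
        exact ⟨y, fun h => absurd h hy⟩
    choose g hg using key
    obtain ⟨h₁, h₂⟩ := h (↑g : Germ (↑u : Filter I) A)
    have hl : ∀ᶠ i in (↑u : Filter I), f i * g i = 0 := Germ.coe_eq.mp h₁
    have hr : ∀ᶠ i in (↑u : Filter I), g i * f i = 0 := Germ.coe_eq.mp h₂
    filter_upwards [hl, hr] with i hli hri using hg i ⟨hli, hri⟩
  · intro h y
    induction y using Germ.inductionOn with
    | _ g =>
      constructor
      · refine Germ.coe_eq.mpr ?_
        filter_upwards [h] with i hi using (hi (g i)).1
      · refine Germ.coe_eq.mpr ?_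
        filter_upwards [h] with i hi using (hi (g i)).2
end

section
/- Let A be a ring (an abelian group with a ℤ-bilinear multiplication, not necessarily associative, commutative, or unital) whose additive group is finitely generated, let I be a set, let u be an ultrafilter on I, and let f : I → A. Then the germ of f lies in (A*)², the additive subgroup of the ultrapower A* = Filter.Germ (↑u) A generated by all products of germs, if and only if the set {i ∈ I | f(i) ∈ A²} belongs to u. -/
open Filter

/-- `A²`: the additive subgroup of a (not necessarily associative/unital) ring `A`
generated by all products `x * y`. -/
def sqSubgroup (A : Type*) [NonUnitalNonAssocRing A] : AddSubgroup A :=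
  AddSubgroup.closure {z : A | ∃ x y : A, z = x * y}

theorem mul_mem_sqSubgroup {A : Type*} [NonUnitalNonAssocRing A] (x y : A) :
    x * y ∈ sqSubgroup A :=
  AddSubgroup.subset_closure ⟨x, y, rfl⟩

/-- If the additive group of `A` is finitely generated, then `A²` has finite width: every element
is a sum of a bounded number of products, whose left factors can even be fixed in advance. -/
theorem exists_forall_mem_sqSubgroup_eq_sum (A : Type*) [NonUnitalNonAssocRing A]
    [Module.Finite ℤ A] :
    ∃ (n : ℕ) (s : Fin n → A), ∀ z ∈ sqSubgroup A, ∃ y : Fin n → A, z = ∑ j, s j * y j := by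
  obtain ⟨n, s, hs⟩ := Module.Finite.exists_fin (R := ℤ) (M := A)
  refine ⟨n, s, fun z hz => ?_⟩
  induction hz using AddSubgroup.closure_induction with
  | mem z hz =>
    obtain ⟨x, y, rfl⟩ := hz
    have hx : x ∈ Submodule.span ℤ (Set.range s) := hs ▸ Submodule.mem_top
    obtain ⟨c, rfl⟩ := (Submodule.mem_span_range_iff_exists_fun ℤ).1 hx
    exact ⟨fun j => c j • y, by simp [Finset.sum_mul, smul_mul_assoc, mul_smul_comm]⟩
  | zero => exact ⟨0, by simp⟩
  | add a b _ _ ha hb =>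
    obtain ⟨y, rfl⟩ := ha
    obtain ⟨w, rfl⟩ := hb
    exact ⟨y + w, by simp [mul_add, Finset.sum_add_distrib]⟩
  | neg a _ ha =>
    obtain ⟨y, rfl⟩ := ha
    exact ⟨-y, by simp⟩

theorem liftPred_mem_sqSubgroup {A I : Type*} [NonUnitalNonAssocRing A] {l : Filter I}
    {g : Germ l A} (hg : g ∈ sqSubgroup (Germ l A)) : g.LiftPred (· ∈ sqSubgroup A) := by
  induction hg using AddSubgroup.closure_induction with
  | mem z hz =>
    obtain ⟨x, y, rfl⟩ := hz
    induction x, y using Germ.inductionOn₂ with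
    | _ x y => exact Eventually.of_forall fun i => mul_mem_sqSubgroup (x i) (y i)
  | zero => exact Eventually.of_forall fun _ => zero_mem (sqSubgroup A)
  | add a b _ _ ha hb =>
    induction a, b using Germ.inductionOn₂ with
    | _ a b =>
      rw [Germ.liftPred_coe] at ha hb
      exact (ha.and hb).mono fun _ h => add_mem h.1 h.2
  | neg a _ ha =>
    induction a using Germ.inductionOn with
    | _ a =>
      rw [Germ.liftPred_coe] at ha
      exact ha.mono fun _ h => neg_mem h

theorem coe_mem_sqSubgroup_of_eventually {A I : Type*} [NonUnitalNonAssocRing A]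
    [Module.Finite ℤ A] {l : Filter I} {f : I → A} (hf : ∀ᶠ i in l, f i ∈ sqSubgroup A) :
    (↑f : Germ l A) ∈ sqSubgroup (Germ l A) := by
  obtain ⟨n, s, hs⟩ := exists_forall_mem_sqSubgroup_eq_sum A
  have hy : ∀ i, ∃ y : Fin n → A, f i ∈ sqSubgroup A → f i = ∑ j, s j * y j := fun i => by
    by_cases h : f i ∈ sqSubgroup A
    · exact (hs _ h).imp fun _ hy _ => hy
    · exact ⟨0, fun h' => absurd h' h⟩
  choose y hy using hy
  have hfy : (↑f : Germ l A) = Germ.coeAddHom l (∑ j, fun i => s j * y i j) :=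
    Germ.coe_eq.2 <| hf.mono fun i hi => by simpa using hy i hi
  rw [hfy, map_sum]
  exact sum_mem fun j _ =>
    mul_mem_sqSubgroup (↑(fun _ : I => s j) : Germ l A) ↑(fun i => y i j)

theorem stmt_11 (A : Type*) [NonUnitalNonAssocRing A] [Module.Finite ℤ A]
    (I : Type*) (u : Ultrafilter I) (f : I → A) :
    (↑f : Germ (↑u : Filter I) A) ∈ sqSubgroup (Germ (↑u : Filter I) A) ↔
      {i : I | f i ∈ sqSubgroup A} ∈ u :=
  ⟨fun h => liftPred_mem_sqSubgroup h, fun h => coe_mem_sqSubgroup_of_eventually h⟩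
end

section
/- Let u be a nonprincipal ultrafilter on ℕ and let ℤ* = Filter.Germ (↑u) ℤ be the corresponding ultrapower of the integers. Then the germ x of the function n ↦ n! is nonzero in ℤ*, and x is divisible by every positive integer: for every integer k ≥ 1 there exists y ∈ ℤ* with k•y = x. In particular, ℤ* contains a nonzero element divisible by every positive integer, whereas ℤ contains none. -/
open Filter

theorem germ_factorial_ne_zero {l : Filter ℕ} [l.NeBot] :
    (↑(fun n : ℕ => (n.factorial : ℤ)) : Germ l ℤ) ≠ 0 := by
  intro h
  obtain ⟨n, hn⟩ := (Germ.coe_eq.mp h).exists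
  exact n.factorial_ne_zero (Int.natCast_eq_zero.mp hn)

theorem exists_smul_eq_germ_factorial {l : Filter ℕ} (hl : l ≤ cofinite) {k : ℤ} (hk : 1 ≤ k) :
    ∃ y : Germ l ℤ, k • y = (↑(fun n : ℕ => (n.factorial : ℤ)) : Germ l ℤ) := by
  refine ⟨↑(fun n : ℕ => (n.factorial : ℤ) / k), ?_⟩
  rw [← Germ.coe_smul, Germ.coe_eq]
  have hge : ∀ᶠ n in l, k.toNat ≤ n :=
    (Nat.cofinite_eq_atTop ▸ hl) (eventually_ge_atTop k.toNat)
  filter_upwards [hge] with n hn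
  have hdvd : k ∣ (n.factorial : ℤ) := by
    rw [← Int.toNat_of_nonneg (by lia : 0 ≤ k)]
    exact_mod_cast Nat.dvd_factorial (by lia) hn
  exact Int.mul_ediv_cancel' hdvd

theorem Int.eq_zero_of_forall_exists_smul_eq {z : ℤ}
    (hz : ∀ k : ℤ, 1 ≤ k → ∃ y : ℤ, k • y = z) : z = 0 := by
  obtain ⟨y, hy⟩ := hz (|z| + 1) (by linarith [abs_nonneg z])
  exact Int.eq_zero_of_abs_lt_dvd (Dvd.intro y hy) (lt_add_one _)

theorem stmt_14 (u : Ultrafilter ℕ) (hu : (↑u : Filter ℕ) ≤ Filter.cofinite) :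
    (↑(fun n : ℕ => (n.factorial : ℤ)) : Germ (↑u : Filter ℕ) ℤ) ≠ 0 ∧
    (∀ k : ℤ, 1 ≤ k → ∃ y : Germ (↑u : Filter ℕ) ℤ,
      k • y = (↑(fun n : ℕ => (n.factorial : ℤ)) : Germ (↑u : Filter ℕ) ℤ)) ∧
    (∃ x : Germ (↑u : Filter ℕ) ℤ, x ≠ 0 ∧ ∀ k : ℤ, 1 ≤ k → ∃ y, k • y = x) ∧
    ¬ ∃ z : ℤ, z ≠ 0 ∧ ∀ k : ℤ, 1 ≤ k → ∃ y : ℤ, k • y = z :=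
  ⟨germ_factorial_ne_zero, fun _ hk => exists_smul_eq_germ_factorial hu hk,
    ⟨_, germ_factorial_ne_zero, fun _ hk => exists_smul_eq_germ_factorial hu hk⟩,
    fun ⟨_, hz, h⟩ => hz (Int.eq_zero_of_forall_exists_smul_eq h)⟩
end

section
/- Let u be a nonprincipal ultrafilter on ℕ and let ℤ* = Filter.Germ (↑u) ℤ be the ultrapower of the integers. Then there exists an additive group homomorphism φ : ℤ* → ℤ* such that φ is not identically zero but φ vanishes on the diagonal copy of ℤ (φ applied to the germ of any constant function is 0). -/
open Filter

/-- The homomorphism of germs induced pointwise by the inclusion of `ℤ` in `ℚ`. -/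
def germIntToRat {α : Type*} (l : Filter α) : Germ l ℤ →+ Germ l ℚ where
  toFun := Germ.map (fun n : ℤ => (n : ℚ))
  map_zero' := congrArg (Germ.ofFun (l := l)) (funext fun _ => Int.cast_zero)
  map_add' x y := by
    induction x, y using Germ.inductionOn₂ with
    | _ f g => exact congrArg (Germ.ofFun (l := l)) (funext fun _ => Int.cast_add _ _)

theorem exists_int_eq_mul_factorial {q : ℚ} {n : ℕ} (h : q.den ≤ n) :
    ∃ m : ℤ, q * n.factorial = m := by
  obtain ⟨k, hk⟩ := Nat.dvd_factorial q.den_pos h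
  refine ⟨q.num * k, ?_⟩
  rw [hk]
  push_cast
  rw [← mul_assoc, Rat.mul_den_eq_num]

/-- The germs at infinity of the sequences `n ↦ q * n!`, which are eventually integral, give a
copy of `ℚ` in the additive group of germs of integer sequences. -/
def ratToGermInt {l : Filter ℕ} (hl : l ≤ cofinite) : ℚ →+ Germ l ℤ where
  toFun q := ((fun n => ⌊q * n.factorial⌋ : ℕ → ℤ) : Germ l ℤ)
  map_zero' := congrArg (Germ.ofFun (l := l)) (funext fun _ => by simp)
  map_add' p q := by
    refine Germ.coe_eq.2 ?_
    have hl' : l ≤ atTop := Nat.cofinite_eq_atTop ▸ hl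
    filter_upwards [hl' (eventually_ge_atTop p.den)] with n hp
    obtain ⟨a, ha⟩ := exists_int_eq_mul_factorial hp
    simp [add_mul, ha]

theorem ratToGermInt_ne_zero {l : Filter ℕ} [l.NeBot] (hl : l ≤ cofinite) {q : ℚ} (hq : q ≠ 0) :
    ratToGermInt hl q ≠ 0 := by
  intro h
  have hl' : l ≤ atTop := Nat.cofinite_eq_atTop ▸ hl
  obtain ⟨n, hn, hd⟩ := ((Germ.coe_eq.1 h).and (hl' (eventually_ge_atTop q.den))).exists
  obtain ⟨m, hm⟩ := exists_int_eq_mul_factorial hd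
  simp only [hm, Int.floor_intCast] at hn
  simp [hn, hq, Nat.factorial_ne_zero] at hm

theorem natCast_germ_notMem_span_one {l : Filter ℕ} [l.NeBot] (hl : l ≤ cofinite) :
    ((fun n => (n : ℚ) : ℕ → ℚ) : Germ l ℚ) ∉ Submodule.span ℚ {(1 : Germ l ℚ)} := by
  intro h
  obtain ⟨q, hq⟩ := Submodule.mem_span_singleton.1 h
  have hl' : l ≤ atTop := Nat.cofinite_eq_atTop ▸ hl
  have hq' : (fun _ => q * 1 : ℕ → ℚ) =ᶠ[l] fun n => (n : ℚ) := Germ.coe_eq.1 hq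
  obtain ⟨n, hn, hlt⟩ :=
    (hq'.and (hl' (tendsto_natCast_atTop_atTop.eventually_gt_atTop q))).exists
  rw [mul_one] at hn
  exact hlt.ne hn

theorem stmt_15 (u : Ultrafilter ℕ) (hu : (↑u : Filter ℕ) ≤ Filter.cofinite) :
    ∃ φ : Germ (↑u : Filter ℕ) ℤ →+ Germ (↑u : Filter ℕ) ℤ,
      φ ≠ 0 ∧ ∀ a : ℤ, φ (↑a : Germ (↑u : Filter ℕ) ℤ) = 0 := by
  obtain ⟨f, hf, hker⟩ := Submodule.exists_le_ker_of_notMem (natCast_germ_notMem_span_one hu)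
  refine ⟨(ratToGermInt hu).comp
    (f.toAddMonoidHom.comp (germIntToRat (u : Filter ℕ))), fun h => ?_, fun a => ?_⟩
  · refine ratToGermInt_ne_zero hu hf ?_
    have hmap : germIntToRat (u : Filter ℕ) ((fun n => (n : ℤ) : ℕ → ℤ) : Germ (u : Filter ℕ) ℤ) =
        ((fun n => (n : ℚ) : ℕ → ℚ) : Germ (u : Filter ℕ) ℚ) :=
      congrArg (Germ.ofFun (l := (u : Filter ℕ))) (funext fun n => Int.cast_natCast n)
    rw [← hmap]
    exact DFunLike.congr_fun h _
  · have hmem : germIntToRat (u : Filter ℕ) (↑a) ∈ Submodule.span ℚ {(1 : Germ (u : Filter ℕ) ℚ)} :=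
      Submodule.mem_span_singleton.2
        ⟨a, congrArg (Germ.ofFun (l := (u : Filter ℕ))) (funext fun _ => mul_one (a : ℚ))⟩
    have h0 : f (germIntToRat (u : Filter ℕ) (↑a)) = 0 := hker hmem
    simp [h0]
end
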